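/- Let p be a prime of the form p = u^2 + v^2 with v even, signs chosen so that u + vi is a p-adic unit (i a fixed square root of -1 in Z_p). Then \sum_{k=0}^{p-1} \binom{2k}{k}^3 64^{-k} \equiv (u + v i)^2 mod p^3 in Z_p. -/

import Mathlib

open Finset

section

open Polynomial

theorem two_mul_prod_one_add_mul {ι R : Type*} [CommRing R] (s : Finset ι) (a : ι → R) (y : R) :
    ∃ c, 2 * ∏ j ∈ s, (1 + a j * y) =
      2 + 2 * y * ∑ j ∈ s, a j + y ^ 2 * ((∑ j ∈ s, a j) ^ 2 - ∑ j ∈ s, a j ^ 2) + y ^ 3 * c := by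
  classical
  induction s using Finset.induction_on with
  | empty => exact ⟨0, by simp⟩
  | insert i s hi ih =>
    obtain ⟨c, hc⟩ := ih
    simp only [prod_insert hi, sum_insert hi]
    refine ⟨c + a i * y * c + a i * ((∑ j ∈ s, a j) ^ 2 - ∑ j ∈ s, a j ^ 2), ?_⟩
    linear_combination (1 + a i * y) * hc

/-- The partial sum `∑_{k ≤ N} w k ∏_{j < k} ((2j+1)² - x²)`. -/
def hyperSum {R : Type*} [CommRing R] (w : ℕ → R) (N : ℕ) (x : R) : R :=
  ∑ k ∈ range (N + 1), w k * ∏ j ∈ range k, ((2 * (j : R) + 1) ^ 2 - x ^ 2)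

theorem prod_odd_sq_sub {R : Type*} [CommRing R] (k : ℕ) (x : R) :
    (x + 1) * (x + 3) * ∏ j ∈ range k, ((2 * (j : R) + 1) ^ 2 - x ^ 2) =
      (∏ j ∈ range k, ((2 * (j : R) + 1 + x) * (2 * j - 3 - x))) *
        ((2 * k - 3 - x) * (2 * k - 1 - x)) := by
  induction k with
  | zero => simp; ring
  | succ k ih =>
    rw [prod_range_succ, prod_range_succ]
    push_cast
    linear_combination ((2 * (k : R) + 1) ^ 2 - x ^ 2) * ih

theorem prod_odd_sq_sub_add_four {R : Type*} [CommRing R] (k : ℕ) (x : R) :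
    (x + 1) * (x + 3) * ∏ j ∈ range k, ((2 * (j : R) + 1) ^ 2 - (x + 4) ^ 2) =
      (∏ j ∈ range k, ((2 * (j : R) + 1 + x) * (2 * j - 3 - x))) *
        ((2 * k + 1 + x) * (2 * k + 3 + x)) := by
  induction k with
  | zero => simp; ring
  | succ k ih =>
    rw [prod_range_succ, prod_range_succ]
    push_cast
    linear_combination ((2 * (k : R) + 1) ^ 2 - (x + 4) ^ 2) * ih

theorem hyperSum_recurrence {R : Type*} [CommRing R] (w : ℕ → R) (N : ℕ)
    (hw : ∀ k < N, 8 * ((k : R) + 1) ^ 3 * w (k + 1) = (2 * k + 1) * w k) (x : R) :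
    (x + 1) * (x + 3) * ((x + 3) ^ 2 * hyperSum w N (x + 4) - (x + 1) ^ 2 * hyperSum w N x) =
      -4 * (x + 2) * (2 * N + 1) * w N *
        ∏ j ∈ range (N + 1), ((2 * (j : R) + 1 + x) * (2 * j - 3 - x)) := by
  induction N with
  | zero => simp [hyperSum]; ring
  | succ N ih =>
    have ih := ih fun k hk => hw k (by lia)
    have h1 := prod_odd_sq_sub (N + 1) x
    have h2 := prod_odd_sq_sub_add_four (N + 1) x
    have h3 := hw N (by lia)
    simp only [hyperSum] at ih ⊢
    rw [sum_range_succ _ (N + 1), sum_range_succ _ (N + 1), prod_range_succ _ (N + 1)]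
    push_cast at h1 h2 h3 ⊢
    linear_combination ih + w (N + 1) * (x + 3) ^ 2 * h2 - w (N + 1) * (x + 1) ^ 2 * h1
      + 4 * (x + 2) * (∏ j ∈ range (N + 1), ((2 * (j : R) + 1 + x) * (2 * j - 3 - x))) * h3

theorem map_hyperSum {R S : Type*} [CommRing R] [CommRing S] (f : R →+* S) (w : ℕ → R) (N : ℕ)
    (x : R) : f (hyperSum w N x) = hyperSum (fun k => f (w k)) N (f x) := by
  simp [hyperSum, map_sum, map_prod, map_ofNat]

theorem hyperSum_one {R : Type*} [CommRing R] (w : ℕ → R) (N : ℕ) :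
    hyperSum w N 1 = w 0 := by
  rw [hyperSum, sum_range_succ']
  simp [prod_range_succ']

/-- Terminating evaluation at `x = 4l+1`. -/
theorem hyperSum_four_mul_add_one {R : Type*} [CommRing R] [IsDomain R] [CharZero R] (w : ℕ → R)
    (N : ℕ) (hw : ∀ k < N, 8 * ((k : R) + 1) ^ 3 * w (k + 1) = (2 * k + 1) * w k) (l : ℕ)
    (hl : 2 * l ≤ N) :
    16 ^ l * hyperSum w N (4 * l + 1) = (Nat.centralBinom l : R) ^ 2 * w 0 := by
  induction l with
  | zero => simp [hyperSum_one]
  | succ l ih =>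
    have ih := ih (by lia)
    have h := hyperSum_recurrence w N hw (4 * l + 1)
    have h0 : ∏ j ∈ range (N + 1),
        ((2 * (j : R) + 1 + (4 * l + 1)) * (2 * j - 3 - (4 * l + 1))) = 0 := by
      apply prod_eq_zero (i := 2 * l + 2) (mem_range.mpr (by lia))
      push_cast; ring
    rw [h0, mul_zero] at h
    have h1 : ((4 * l + 1 : R) + 1) * (4 * l + 1 + 3) ≠ 0 := by
      have : (((4 * l + 2) * (4 * l + 4) : ℕ) : R) ≠ 0 := by
        rw [Nat.cast_ne_zero]; positivity
      push_cast at this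
      convert this using 1; ring
    have h2 := (mul_eq_zero.mp h).resolve_left h1
    have h3 : ((l : R) + 1) * Nat.centralBinom (l + 1) = 2 * (2 * l + 1) * Nat.centralBinom l := by
      exact_mod_cast Nat.succ_mul_centralBinom_succ l
    have h4 : ((l : R) + 1) ^ 2 ≠ 0 := by
      apply pow_ne_zero; exact_mod_cast (Nat.succ_ne_zero l)
    apply mul_left_cancel₀ h4
    push_cast
    rw [show (4 * ((l : R) + 1) + 1) = 4 * l + 1 + 4 by ring]
    linear_combination 16 ^ l * h2 + 4 * (2 * l + 1) ^ 2 * ih -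
      w 0 * (((l : R) + 1) * Nat.centralBinom (l + 1) + 2 * (2 * l + 1) * Nat.centralBinom l) * h3

theorem sq_X_sub_C_dvd_of_recurrence {K : Type*} [Field K] (h2 : (2 : K) ≠ 0) (f : K[X])
    (hf : (X + 3) ^ 2 * f.comp (X + 4) = (X + 1) ^ 2 * f) (n : ℕ)
    (h3 : ∀ j : ℕ, j + 1 < n → (4 * j + 6 : K) ≠ 0) (j : ℕ) (hj : j < n) :
    (X - C (4 * j + 3 : K)) ^ 2 ∣ f := by
  have key : ∀ r : K, r ≠ -3 → (X - C r) ^ 2 ∣ (X + 1) ^ 2 * f → (X - C (r + 4)) ^ 2 ∣ f := by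
    intro r hr hdvd
    rw [← hf] at hdvd
    have hcop : IsCoprime ((X - C r) ^ 2) ((X + 3 : K[X]) ^ 2) := by
      apply IsCoprime.pow
      have := isCoprime_X_sub_C_of_isUnit_sub (R := K) (a := r) (b := -3)
        (by rw [isUnit_iff_ne_zero, sub_ne_zero]; exact hr)
      rwa [C_neg, sub_neg_eq_add, show (C (3 : K) : K[X]) = 3 from rfl] at this
    have h := hcop.dvd_of_dvd_mul_left hdvd
    obtain ⟨g, hg⟩ := h
    refine ⟨g.comp (X - 4), ?_⟩
    have h5 := congrArg (fun q : K[X] => q.comp (X - 4)) hg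
    simp only [comp_assoc, mul_comp, pow_comp, sub_comp, add_comp, X_comp, C_comp] at h5
    rw [show ((4 : K[X]).comp (X - 4)) = 4 from natCast_comp (n := 4)] at h5
    rw [sub_add_cancel, comp_X] at h5
    rw [h5, C_add, show (C (4 : K) : K[X]) = 4 from rfl]
    ring
  induction j with
  | zero =>
    have := key (-1) (by
      intro h; apply h2; linear_combination h) (by
      simp)
    convert this using 4
    norm_num
  | succ j ih =>
    have := key (4 * j + 3) (by
      intro h; apply h3 j hj; linear_combination h) (Dvd.dvd.mul_left (ih (by lia)) _)
    convert this using 4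
    push_cast; ring

theorem coeff_two_of_eq_prod {K ι : Type*} [Field K] (h2 : (2 : K) ≠ 0) (f : K[X]) (s : Finset ι)
    (r : ι → K) (hr : ∀ j ∈ s, r j ≠ 0) (c : K) (hf : f = C c * ∏ j ∈ s, (X - C (r j)) ^ 2)
    (h1 : f.coeff 1 = 0) : f.coeff 2 = - f.coeff 0 * ∑ j ∈ s, (r j)⁻¹ ^ 2 := by
  set P : K[X] := ∏ j ∈ s, (1 + C (-(r j)⁻¹) * X) with hP
  set p1 : K := ∑ j ∈ s, (r j)⁻¹
  set p2 : K := ∑ j ∈ s, (r j)⁻¹ ^ 2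
  obtain ⟨d, hd⟩ := two_mul_prod_one_add_mul s (fun j => (C (-(r j)⁻¹) : K[X])) X
  rw [← hP] at hd
  have e1 : ∑ j ∈ s, (C (-(r j)⁻¹) : K[X]) = C (-p1) := by
    rw [← map_sum, sum_neg_distrib]
  have e2 : ∑ j ∈ s, (C (-(r j)⁻¹) : K[X]) ^ 2 = C p2 := by
    simp only [← C_pow, neg_sq]; rw [← map_sum]
  rw [e1, e2] at hd
  have hf' : f = C (c * ∏ j ∈ s, r j ^ 2) * P ^ 2 := by
    rw [hf, hP, C_mul, map_prod, mul_assoc, ← prod_pow, ← prod_mul_distrib]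
    congr 1
    refine prod_congr rfl fun j hj => ?_
    have : (C (r j) : K[X]) * C (r j)⁻¹ = 1 := by rw [← C_mul, mul_inv_cancel₀ (hr j hj), C_1]
    rw [C_pow, C_neg]
    linear_combination (-2 * C (r j) * X + X ^ 2 * (C (r j) * C (r j)⁻¹ + 1)) * (- this)
  set f0 := c * ∏ j ∈ s, r j ^ 2
  have h4 : (4 : K) ≠ 0 := by
    rw [show (4 : K) = 2 * 2 by norm_num]; exact mul_ne_zero h2 h2
  have hfe : C 4 * f = C (4 * f0) + C (- 8 * f0 * p1) * X +
      C (4 * f0 * (2 * p1 ^ 2 - p2)) * X ^ 2 + X ^ 3 * (C f0 * (4 * d - 4 * C p1 * X * d +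
        2 * X ^ 2 * (C p1 ^ 2 - C p2) * d + X ^ 3 * d ^ 2 - 4 * C p1 * (C p1 ^ 2 - C p2)
        + X * (C p1 ^ 2 - C p2) ^ 2)) := by
    have : C 4 * f = C f0 * (2 * P) ^ 2 := by
      rw [hf', show (C 4 : K[X]) = 4 from rfl]; ring
    rw [this, hd]
    simp only [C_mul, C_neg, C_sub, C_pow, show (C 4 : K[X]) = 4 from rfl,
      show (C 8 : K[X]) = 8 from rfl, show (C 2 : K[X]) = 2 from rfl]
    ring
  have hco : ∀ (a0 a1 a2 : K) (q : K[X]),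
      (C a0 + C a1 * X + C a2 * X ^ 2 + X ^ 3 * q).coeff 0 = a0 ∧
      (C a0 + C a1 * X + C a2 * X ^ 2 + X ^ 3 * q).coeff 1 = a1 ∧
      (C a0 + C a1 * X + C a2 * X ^ 2 + X ^ 3 * q).coeff 2 = a2 := by
    intro a0 a1 a2 q
    simp [coeff_X_pow, coeff_X_pow_mul', coeff_X, coeff_C]
  have c0 : f.coeff 0 = f0 := by
    apply mul_left_cancel₀ h4
    rw [← coeff_C_mul, hfe, (hco _ _ _ _).1]
  have c1 : 4 * f.coeff 1 = -8 * f0 * p1 := by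
    rw [← coeff_C_mul, hfe, (hco _ _ _ _).2.1]
  have c2 : 4 * f.coeff 2 = 4 * f0 * (2 * p1 ^ 2 - p2) := by
    rw [← coeff_C_mul, hfe, (hco _ _ _ _).2.2]
  rw [h1, mul_zero] at c1
  have : f0 * p1 = 0 := by
    have h8 : (8 : K) ≠ 0 := by
      rw [show (8 : K) = 2 * 4 by norm_num]; exact mul_ne_zero h2 h4
    apply mul_left_cancel₀ h8; linear_combination c1
  apply mul_left_cancel₀ h4
  rw [c0]
  linear_combination c2 + 8 * p1 * this

theorem natDegree_hyperSum_X_le {R : Type*} [CommRing R] (w : ℕ → R) (N : ℕ) :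
    (hyperSum (fun k => C (w k)) N (X : R[X])).natDegree ≤ 2 * N := by
  refine natDegree_sum_le_of_forall_le _ _ fun k hk => ?_
  refine (natDegree_C_mul_le _ _).trans ?_
  refine (natDegree_prod_le _ _).trans ?_
  have hk := mem_range.mp hk
  calc _ ≤ ∑ _j ∈ range k, 2 := by
        refine sum_le_sum fun j _ => ?_
        rw [show (2 * (j : R[X]) + 1) ^ 2 = C ((2 * (j : R) + 1) ^ 2) by simp [C_ofNat]]
        refine (natDegree_sub_le _ _).trans ?_
        rw [natDegree_C]
        simp only [zero_le, sup_of_le_right, natDegree_X_pow_le]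
    _ ≤ 2 * N := by simp; lia

theorem coeff_one_hyperSum_X {R : Type*} [CommRing R] (w : ℕ → R) (N : ℕ) :
    (hyperSum (fun k => C (w k)) N (X : R[X])).coeff 1 = 0 := by
  have key : ∀ k, (∏ j ∈ range k, ((2 * (j : R[X]) + 1) ^ 2 - X ^ 2)) =
      (∏ j ∈ range k, ((2 * (j : R[X]) + 1) ^ 2 - X)).comp (X ^ 2) := by
    intro k
    rw [Polynomial.prod_comp]
    refine prod_congr rfl fun j _ => ?_
    rw [show (2 * (j : R[X]) + 1) ^ 2 = C ((2 * (j : R) + 1) ^ 2) by simp [C_ofNat]]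
    simp
  simp only [hyperSum, finsetSum_coeff, coeff_C_mul]
  refine sum_eq_zero fun k _ => ?_
  rw [key, ← expand_eq_comp_X_pow, coeff_expand (by norm_num)]
  simp

theorem coeff_two_hyperSum_X {p : ℕ} [Fact p.Prime] {m : ℕ} (hpm : p = 4 * m + 1)
    (w : ℕ → ZMod p)
    (hw : ∀ k < 2 * m, 8 * ((k : ZMod p) + 1) ^ 3 * w (k + 1) = (2 * k + 1) * w k) :
    (hyperSum (fun k => C (w k)) (2 * m) (X : (ZMod p)[X])).coeff 2 =
      - (hyperSum (fun k => C (w k)) (2 * m) (X : (ZMod p)[X])).coeff 0 *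
        ∑ j ∈ range (2 * m), ((4 * j + 3 : ZMod p))⁻¹ ^ 2 := by
  have hcast : ∀ a : ℕ, (a : ZMod p) = 0 → p ∣ a := fun a => (ZMod.natCast_eq_zero_iff a p).mp
  have hp := Fact.out (p := p.Prime)
  have h2 : (2 : ZMod p) ≠ 0 := by
    intro h
    have := Nat.le_of_dvd (by norm_num) (hcast 2 (by exact_mod_cast h))
    have := hp.two_le
    lia
  have h4 : (4 : ZMod p) ≠ 0 := by
    rw [show (4 : ZMod p) = 2 * 2 by norm_num]; exact mul_ne_zero h2 h2
  set f := hyperSum (fun k => C (w k)) (2 * m) (X : (ZMod p)[X]) with hfdef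
  have hrec : (X + 3) ^ 2 * f.comp (X + 4) = (X + 1) ^ 2 * f := by
    have h := hyperSum_recurrence (fun k => (C (w k) : (ZMod p)[X])) (2 * m) (by
      intro k hk
      have := congrArg (C : ZMod p → (ZMod p)[X]) (hw k hk)
      simpa [C_ofNat] using this) X
    have h0 : (2 * ((2 * m : ℕ) : (ZMod p)[X]) + 1) = 0 := by
      have : ((4 * m + 1 : ℕ) : (ZMod p)[X]) = 0 := by
        rw [← hpm, ← C_eq_natCast]; simp
      rw [← this]; push_cast; ring
    rw [h0] at h
    have hX : ((X : (ZMod p)[X]) + 1) * (X + 3) ≠ 0 :=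
      mul_ne_zero (by simpa using X_add_C_ne_zero (1 : ZMod p))
        (by simpa [C_ofNat] using X_add_C_ne_zero (3 : ZMod p))
    have h' := (mul_eq_zero.mp (h.trans (by ring))).resolve_left hX
    have hcomp : f.comp (X + 4) = hyperSum (fun k => C (w k)) (2 * m) (X + 4) := by
      have := map_hyperSum (compRingHom (X + 4 : (ZMod p)[X])) (fun k => C (w k)) (2 * m) X
      simpa using this
    rw [hcomp]
    exact sub_eq_zero.mp h'
  have hroots := sq_X_sub_C_dvd_of_recurrence h2 f hrec (2 * m) (by
    intro j hj h
    have h' : (2 : ZMod p) * ((2 * j + 3 : ℕ) : ZMod p) = 0 := by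
      push_cast; linear_combination h
    have := Nat.le_of_dvd (by lia) (hcast _ ((mul_eq_zero.mp h').resolve_left h2))
    lia)
  have hinj : ∀ i < 2 * m, ∀ j < 2 * m, i ≠ j → (4 * (i : ZMod p) + 3) ≠ 4 * j + 3 := by
    intro i hi j hj hij h
    have h' : (i : ZMod p) = j := mul_left_cancel₀ h4 (by linear_combination h)
    rw [ZMod.natCast_eq_natCast_iff', Nat.mod_eq_of_lt (by lia), Nat.mod_eq_of_lt (by lia)] at h'
    exact hij h'
  have hprod : (∏ j ∈ range (2 * m), (X - C (4 * (j : ZMod p) + 3)) ^ 2) ∣ f := by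
    refine Finset.prod_dvd_of_coprime ?_ fun j hj => hroots j (mem_range.mp hj)
    intro i hi j hj hij
    apply IsCoprime.pow
    apply isCoprime_X_sub_C_of_isUnit_sub
    rw [isUnit_iff_ne_zero, sub_ne_zero]
    exact hinj i (by simpa using hi) j (by simpa using hj) hij
  obtain ⟨g, hg⟩ := hprod
  have hmonic : (∏ j ∈ range (2 * m), (X - C (4 * (j : ZMod p) + 3)) ^ 2).Monic :=
    monic_prod_of_monic _ _ fun j _ => (monic_X_sub_C _).pow 2
  have hdeg : (∏ j ∈ range (2 * m), (X - C (4 * (j : ZMod p) + 3)) ^ 2).natDegree = 4 * m := by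
    rw [natDegree_prod_of_monic _ _ fun j _ => (monic_X_sub_C _).pow 2]
    simp only [natDegree_pow, natDegree_X_sub_C, sum_const, card_range, smul_eq_mul]; ring
  have hgC : ∃ c, g = C c := by
    refine ⟨g.coeff 0, eq_C_of_natDegree_eq_zero ?_⟩
    by_cases hg0 : g = 0
    · simp [hg0]
    have := natDegree_hyperSum_X_le w (2 * m)
    rw [← hfdef, hg, hmonic.natDegree_mul' hg0, hdeg] at this
    lia
  obtain ⟨c, rfl⟩ := hgC
  refine coeff_two_of_eq_prod h2 f (range (2 * m)) _ ?_ c (by rw [hg, mul_comm])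
    (coeff_one_hyperSum_X _ _)
  intro j hj h
  have hj := mem_range.mp hj
  obtain ⟨e, he⟩ := hcast (4 * j + 3) (by push_cast; exact h)
  have : e < 2 := by
    by_contra hcon
    have : p * 2 ≤ p * e := Nat.mul_le_mul_left _ (by lia)
    lia
  interval_cases e <;> lia

theorem sum_range_two_mul_eq_even_add_odd {M : Type*} [AddCommMonoid M] (g : ℕ → M) (m : ℕ) :
    ∑ j ∈ range (2 * m), g j = ∑ j ∈ range m, g (2 * j) + ∑ j ∈ range m, g (2 * j + 1) := by
  induction m with
  | zero => simp
  | succ m ih =>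
    rw [show 2 * (m + 1) = 2 * m + 1 + 1 by ring, sum_range_succ, sum_range_succ, sum_range_succ,
      sum_range_succ, ih]
    abel

theorem ZMod.sum_univ_eq_sum_range {p : ℕ} [Fact p.Prime] {M : Type*} [AddCommMonoid M]
    (g : ZMod p → M) : ∑ x, g x = ∑ j ∈ range p, g j := by
  symm
  refine sum_bij (fun j _ => (j : ZMod p)) (fun _ _ => mem_univ _) ?_ ?_ (fun _ _ => rfl)
  · intro i hi j hj h
    rwa [ZMod.natCast_eq_natCast_iff', Nat.mod_eq_of_lt (mem_range.mp hi),
      Nat.mod_eq_of_lt (mem_range.mp hj)] at h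
  · intro x _
    exact ⟨x.val, mem_range.mpr (ZMod.val_lt x), by simp⟩

theorem ZMod.sum_inv_pow_eq_zero {p : ℕ} [Fact p.Prime] {i : ℕ} (hi0 : i ≠ 0) (hi : i < p - 1) :
    ∑ j ∈ range (p - 1), ((j + 1 : ZMod p))⁻¹ ^ i = 0 := by
  have h1 : ∑ x : ZMod p, x⁻¹ ^ i = 0 := by
    rw [← FiniteField.sum_pow_lt_card_sub_one (K := ZMod p) i (by rwa [ZMod.card])]
    exact Equiv.sum_comp (Equiv.inv (ZMod p)) (fun x => x ^ i)
  rw [ZMod.sum_univ_eq_sum_range] at h1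
  have hp := Fact.out (p := p.Prime)
  obtain ⟨q, rfl⟩ : ∃ q, p = q + 1 := ⟨p - 1, by have := hp.pos; lia⟩
  rw [sum_range_succ'] at h1
  simpa [hi0] using h1

theorem ZMod.sum_inv_sq_half {p : ℕ} [Fact p.Prime] {m : ℕ} (hpm : p = 4 * m + 1) :
    ∑ j ∈ range (2 * m), ((j + 1 : ZMod p))⁻¹ ^ 2 = 0 := by
  have hp := Fact.out (p := p.Prime)
  have hm : 0 < m := by
    rcases Nat.eq_zero_or_pos m with rfl | h
    · exact absurd hp (by rw [hpm]; decide)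
    · exact h
  have h := ZMod.sum_inv_pow_eq_zero (p := p) (i := 2) (by norm_num) (by lia)
  have h0 : (4 * (m : ZMod p) + 1) = 0 := by
    have : ((4 * m + 1 : ℕ) : ZMod p) = 0 := by rw [← hpm]; simp
    exact_mod_cast this
  rw [show p - 1 = 2 * m + 2 * m by lia, sum_range_add,
    ← sum_range_reflect (fun x => ((((2 * m + x : ℕ) : ZMod p) + 1)⁻¹ ^ 2)),
    ← sum_add_distrib] at h
  have h2 : (2 : ZMod p) ≠ 0 := by
    intro h
    have := Nat.le_of_dvd (by norm_num) ((ZMod.natCast_eq_zero_iff 2 p).mp (by exact_mod_cast h))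
    lia
  apply mul_left_cancel₀ h2
  rw [mul_zero, mul_sum, ← h]
  refine sum_congr rfl fun j hj => ?_
  have hj := mem_range.mp hj
  have : (((2 * m + (2 * m - 1 - j) : ℕ) : ZMod p) + 1) = - (j + 1) := by
    have h3 : ((2 * m + (2 * m - 1 - j) + 1 + (j + 1) : ℕ) : ZMod p) = 4 * m + 1 := by
      rw [show 2 * m + (2 * m - 1 - j) + 1 + (j + 1) = 4 * m + 1 by lia]; push_cast; ring
    rw [h0] at h3
    push_cast at h3 ⊢
    linear_combination h3
  rw [this, inv_neg, neg_sq]; ring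

theorem ZMod.sum_inv_sq_four_mul_add_three {p : ℕ} [Fact p.Prime] {m : ℕ} (hpm : p = 4 * m + 1) :
    8 * ∑ j ∈ range (2 * m), ((4 * j + 3 : ZMod p))⁻¹ ^ 2 =
      ∑ j ∈ range m, ((m + j + 1 : ZMod p))⁻¹ ^ 2 := by
  have hp := Fact.out (p := p.Prime)
  have h0 : (4 * (m : ZMod p) + 1) = 0 := by
    have : ((4 * m + 1 : ℕ) : ZMod p) = 0 := by rw [← hpm]; simp
    exact_mod_cast this
  have h2 : (2 : ZMod p) ≠ 0 := by
    intro h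
    have := Nat.le_of_dvd (by norm_num) ((ZMod.natCast_eq_zero_iff 2 p).mp (by exact_mod_cast h))
    have := hp.two_le
    lia
  have h4 : (4 : ZMod p) * 2⁻¹ ^ 2 = 1 := by field_simp; norm_num
  have hs := ZMod.sum_inv_sq_half hpm
  have hs' := hs
  rw [sum_range_two_mul_eq_even_add_odd] at hs
  rw [two_mul, sum_range_add] at hs'
  have e1 : ∑ j ∈ range m, ((((2 * j + 1 : ℕ) : ZMod p) + 1)⁻¹ ^ 2) =
      2⁻¹ ^ 2 * ∑ j ∈ range m, ((j + 1 : ZMod p))⁻¹ ^ 2 := by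
    rw [mul_sum]
    refine sum_congr rfl fun j _ => ?_
    rw [← mul_pow, ← mul_inv]; congr 2; push_cast; ring
  rw [two_mul, sum_range_add, ← sum_range_reflect]
  have e2 : ∑ j ∈ range m, ((4 * ((m - 1 - j : ℕ) : ZMod p) + 3)⁻¹ ^ 2) =
      2⁻¹ ^ 2 * ∑ j ∈ range m, ((((2 * j : ℕ) : ZMod p) + 1)⁻¹ ^ 2) := by
    rw [mul_sum]
    refine sum_congr rfl fun j hj => ?_
    have hj := mem_range.mp hj
    have h3 : ((4 * (m - 1 - j) + 3 + 2 * (2 * j + 1) : ℕ) : ZMod p) = 4 * m + 1 := by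
      rw [show 4 * (m - 1 - j) + 3 + 2 * (2 * j + 1) = 4 * m + 1 by lia]; push_cast; ring
    rw [h0] at h3
    rw [← mul_pow, ← mul_inv, ← neg_sq, ← inv_neg]; congr 2
    push_cast at h3 ⊢
    linear_combination -h3
  have e3 : ∑ j ∈ range m, ((4 * ((m + j : ℕ) : ZMod p) + 3)⁻¹ ^ 2) =
      2⁻¹ ^ 2 * ∑ j ∈ range m, ((((2 * j : ℕ) : ZMod p) + 1)⁻¹ ^ 2) := by
    rw [mul_sum]
    refine sum_congr rfl fun j hj => ?_
    rw [← mul_pow, ← mul_inv]; congr 2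
    push_cast
    linear_combination h0
  rw [e2, e3]
  push_cast at hs hs' e1 ⊢
  linear_combination 4 * h4 * (∑ j ∈ range m, ((2 * j + 1 : ZMod p)⁻¹ ^ 2)) + 4 * hs - hs'
    - 4 * e1 - h4 * (∑ j ∈ range m, ((j + 1 : ZMod p))⁻¹ ^ 2)

theorem PadicInt.isUnit_natCast_of_lt {p : ℕ} [Fact p.Prime] {a : ℕ} (h0 : 0 < a) (h : a < p) :
    IsUnit (a : ℤ_[p]) := by
  rw [PadicInt.isUnit_iff, PadicInt.norm_natCast_eq_one_iff]
  exact Nat.coprime_of_lt_prime h0.ne' h Fact.out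

theorem PadicInt.toZMod_eq_zero_iff {p : ℕ} [Fact p.Prime] (x : ℤ_[p]) :
    PadicInt.toZMod x = 0 ↔ (p : ℤ_[p]) ∣ x := by
  rw [← RingHom.mem_ker, PadicInt.ker_toZMod, PadicInt.maximalIdeal_eq_span_p,
    Ideal.mem_span_singleton]

theorem PadicInt.toZMod_ringInverse {p : ℕ} [Fact p.Prime] {x : ℤ_[p]} (hx : IsUnit x) :
    PadicInt.toZMod (Ring.inverse x) = (PadicInt.toZMod x)⁻¹ := by
  have h := congrArg PadicInt.toZMod (Ring.mul_inverse_cancel x hx)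
  rw [map_mul, map_one] at h
  exact eq_inv_of_mul_eq_one_right h

theorem PadicInt.pow_three_dvd_hyperSum_sub {p : ℕ} [Fact p.Prime] {m : ℕ} (hpm : p = 4 * m + 1)
    (w : ℕ → ℤ_[p])
    (hw : ∀ k < 2 * m, 8 * ((k : ℤ_[p]) + 1) ^ 3 * w (k + 1) = (2 * k + 1) * w k)
    (s : ℤ_[p])
    (hs : PadicInt.toZMod s = ∑ j ∈ range (2 * m), ((4 * j + 3 : ZMod p))⁻¹ ^ 2) :
    (p : ℤ_[p]) ^ 3 ∣ hyperSum w (2 * m) p - hyperSum w (2 * m) 0 * (1 - p ^ 2 * s) := by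
  set F := hyperSum (fun k => C (w k)) (2 * m) (X : ℤ_[p][X]) with hF
  have hev : ∀ x, hyperSum w (2 * m) x = F.eval x := by
    intro x
    have := map_hyperSum (evalRingHom x) (fun k => C (w k)) (2 * m) X
    simpa using this.symm
  have hmap : F.map PadicInt.toZMod =
      hyperSum (fun k => C (PadicInt.toZMod (w k))) (2 * m) X := by
    have := map_hyperSum (mapRingHom (PadicInt.toZMod (p := p))) (fun k => C (w k)) (2 * m) X
    simpa using this
  have h2 := coeff_two_hyperSum_X hpm (fun k => PadicInt.toZMod (w k)) (by
    intro k hk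
    have := congrArg PadicInt.toZMod (hw k hk)
    simpa [map_ofNat] using this)
  rw [← hmap, coeff_map, coeff_map, ← hs] at h2
  have h2' : (p : ℤ_[p]) ∣ F.coeff 2 + F.coeff 0 * s := by
    rw [← PadicInt.toZMod_eq_zero_iff]
    simp [h2]
  obtain ⟨e, he⟩ := h2'
  have h1 : F.coeff 1 = 0 := coeff_one_hyperSum_X w (2 * m)
  have hX : (p : ℤ_[p]) ^ 3 ∣ F.eval (p : ℤ_[p]) -
      (F.coeff 0 + F.coeff 1 * p + F.coeff 2 * p ^ 2) := by
    have : F =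
        X * (X * (X * F.divX.divX.divX + C (F.coeff 2)) + C (F.coeff 1)) + C (F.coeff 0) := by
      conv_lhs => rw [← divX_mul_X_add F, ← divX_mul_X_add F.divX, ← divX_mul_X_add F.divX.divX]
      simp only [coeff_divX]
      ring
    refine ⟨F.divX.divX.divX.eval (p : ℤ_[p]), ?_⟩
    conv_lhs => rw [this]
    simp only [eval_add, eval_mul, eval_X, eval_C]
    simp
    ring
  obtain ⟨d, hd⟩ := hX
  rw [hev, hev, ← coeff_zero_eq_eval_zero]
  refine ⟨d + e, ?_⟩
  rw [h1] at hd
  linear_combination hd + p ^ 2 * he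

/-- A `p`-adic integral sequence with `w k = (2k-1)!! / (8^k k!^3)` for `k < p`. -/
noncomputable def hyperWeight (p : ℕ) [Fact p.Prime] (k : ℕ) : ℤ_[p] :=
  ∏ j ∈ range k, ((2 * (j : ℤ_[p]) + 1) * Ring.inverse (8 * ((j : ℤ_[p]) + 1) ^ 3))

theorem PadicInt.isUnit_ofNat_two {p : ℕ} [Fact p.Prime] (hp : 2 < p) : IsUnit (2 : ℤ_[p]) :=
  mod_cast PadicInt.isUnit_natCast_of_lt (p := p) (a := 2) (by norm_num) hp

theorem hyperWeight_succ {p : ℕ} [Fact p.Prime] (hp : 2 < p) {k : ℕ} (hk : k + 1 < p) :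
    8 * ((k : ℤ_[p]) + 1) ^ 3 * hyperWeight p (k + 1) = (2 * k + 1) * hyperWeight p k := by
  have h : IsUnit (8 * ((k : ℤ_[p]) + 1) ^ 3) := by
    rw [show (8 : ℤ_[p]) = 2 ^ 3 by norm_num]
    refine ((PadicInt.isUnit_ofNat_two hp).pow 3).mul (IsUnit.pow 3 ?_)
    exact_mod_cast PadicInt.isUnit_natCast_of_lt (p := p) (a := k + 1) (by lia) hk
  rw [hyperWeight, prod_range_succ, ← hyperWeight]
  linear_combination hyperWeight p k * (2 * (k : ℤ_[p]) + 1) * Ring.mul_inverse_cancel _ h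

theorem choose_pow_three_mul_eq {p : ℕ} [Fact p.Prime] (hp : 2 < p) {k : ℕ} (hk : k < p) :
    (Nat.choose (2 * k) k : ℤ_[p]) ^ 3 * (Ring.inverse (64 : ℤ_[p])) ^ k =
      hyperWeight p k * ∏ j ∈ range k, ((2 * (j : ℤ_[p]) + 1) ^ 2 - 0 ^ 2) := by
  have h2 := PadicInt.isUnit_ofNat_two hp
  have h64 : IsUnit (64 : ℤ_[p]) := by
    rw [show (64 : ℤ_[p]) = 2 ^ 6 by norm_num]; exact h2.pow 6
  induction k with
  | zero => simp [hyperWeight]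
  | succ k ih =>
    have ih := ih (by lia)
    have h : IsUnit (8 * ((k : ℤ_[p]) + 1) ^ 3) := by
      rw [show (8 : ℤ_[p]) = 2 ^ 3 by norm_num]
      refine (h2.pow 3).mul (IsUnit.pow 3 ?_)
      exact_mod_cast PadicInt.isUnit_natCast_of_lt (p := p) (a := k + 1) (by lia) hk
    apply h.mul_left_cancel
    have h3 : ((k : ℤ_[p]) + 1) * Nat.choose (2 * (k + 1)) (k + 1) =
        2 * (2 * k + 1) * Nat.choose (2 * k) k := by
      exact_mod_cast Nat.succ_mul_centralBinom_succ k
    have h4 : (((k : ℤ_[p]) + 1) * Nat.choose (2 * (k + 1)) (k + 1)) ^ 3 =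
        (2 * (2 * k + 1) * Nat.choose (2 * k) k) ^ 3 := by rw [h3]
    have h5 := hyperWeight_succ hp hk
    have h6 := Ring.mul_inverse_cancel _ h64
    rw [prod_range_succ, pow_succ]
    linear_combination 8 * Ring.inverse (64 : ℤ_[p]) ^ k * Ring.inverse (64 : ℤ_[p]) * h4
      + (2 * (k : ℤ_[p]) + 1) ^ 3 * ih
      + (Nat.choose (2 * k) k : ℤ_[p]) ^ 3 * (2 * (k : ℤ_[p]) + 1) ^ 3 *
        Ring.inverse (64 : ℤ_[p]) ^ k * h6
      - (∏ j ∈ range k, ((2 * (j : ℤ_[p]) + 1) ^ 2 - 0 ^ 2)) * (2 * k + 1) ^ 2 * h5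

theorem pow_three_dvd_sum_sub_hyperSum {p : ℕ} [Fact p.Prime] {n : ℕ} (hn : 0 < n)
    (hpn : p = 2 * n + 1) :
    (p : ℤ_[p]) ^ 3 ∣ (∑ k ∈ range p,
      ((Nat.choose (2 * k) k : ℤ_[p]) ^ 3 * (Ring.inverse (64 : ℤ_[p])) ^ k)) -
        hyperSum (hyperWeight p) n 0 := by
  have e : hyperSum (hyperWeight p) n 0 = ∑ k ∈ range (n + 1),
      ((Nat.choose (2 * k) k : ℤ_[p]) ^ 3 * (Ring.inverse (64 : ℤ_[p])) ^ k) := by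
    refine sum_congr rfl fun k hk => ?_
    have hk := mem_range.mp hk
    rw [choose_pow_three_mul_eq (by lia) (by lia)]
  obtain ⟨q, hq⟩ : ∃ q, p = n + 1 + q := ⟨n, by lia⟩
  have hr : range p = range (n + 1 + q) := by rw [← hq]
  rw [e, hr, sum_range_add, add_sub_cancel_left]
  refine dvd_sum fun k hk => ?_
  have hk := mem_range.mp hk
  apply Dvd.dvd.mul_right
  apply pow_dvd_pow_of_dvd
  have hp := Fact.out (p := p.Prime)
  have : p ∣ Nat.choose (2 * (n + 1 + k)) (n + 1 + k) :=
    hp.dvd_choose (by lia) (by lia) (by lia)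
  exact_mod_cast (Nat.cast_dvd_cast (α := ℤ_[p]) this)

/-- The sum modulo `p ^ 3` in terms of a central binomial coefficient. -/
theorem pow_three_dvd_sum_sub_centralBinom {p : ℕ} [Fact p.Prime] {m : ℕ} (hpm : p = 4 * m + 1)
    (s : ℤ_[p])
    (hs : 8 * PadicInt.toZMod s = ∑ j ∈ range m, ((m + j + 1 : ZMod p))⁻¹ ^ 2) :
    (p : ℤ_[p]) ^ 3 ∣ 16 ^ m * (∑ k ∈ range p,
      ((Nat.choose (2 * k) k : ℤ_[p]) ^ 3 * (Ring.inverse (64 : ℤ_[p])) ^ k)) -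
        (Nat.centralBinom m : ℤ_[p]) ^ 2 * (1 + p ^ 2 * s) := by
  have hp := Fact.out (p := p.Prime)
  have hm : 0 < m := by
    rcases Nat.eq_zero_or_pos m with rfl | h
    · exact absurd hp (by rw [hpm]; decide)
    · exact h
  have hw : ∀ k < 2 * m, 8 * ((k : ℤ_[p]) + 1) ^ 3 * hyperWeight p (k + 1) =
      (2 * k + 1) * hyperWeight p k := fun k hk => hyperWeight_succ (by lia) (by lia)
  have h8 : (8 : ZMod p) ≠ 0 := by
    intro h
    have h' : ((2 ^ 3 : ℕ) : ZMod p) = 0 := by push_cast; linear_combination h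
    have := Nat.le_of_dvd (by norm_num)
      (hp.dvd_of_dvd_pow ((ZMod.natCast_eq_zero_iff _ p).mp h'))
    lia
  obtain ⟨a, ha⟩ := PadicInt.pow_three_dvd_hyperSum_sub hpm (hyperWeight p) hw s (by
    apply mul_left_cancel₀ h8
    rw [hs, ZMod.sum_inv_sq_four_mul_add_three hpm])
  obtain ⟨b, hb⟩ := pow_three_dvd_sum_sub_hyperSum (p := p) (n := 2 * m) (by lia) (by lia)
  have hc := hyperSum_four_mul_add_one (hyperWeight p) (2 * m) hw m le_rfl
  have hp' : (4 * (m : ℤ_[p]) + 1) = p := by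
    have : ((4 * m + 1 : ℕ) : ℤ_[p]) = p := by rw [← hpm]
    exact_mod_cast this
  rw [hp', show hyperWeight p 0 = 1 by simp [hyperWeight], mul_one] at hc
  refine ⟨16 ^ m * b - 16 ^ m * a * (1 + p ^ 2 * s) +
    p * s ^ 2 * 16 ^ m * hyperSum (hyperWeight p) (2 * m) 0, ?_⟩
  linear_combination 16 ^ m * hb + (1 + p ^ 2 * s) * hc - 16 ^ m * (1 + p ^ 2 * s) * ha

theorem Nat.choose_mul_mul_ascFactorial_one (m : ℕ) :
    Nat.factorial m * Nat.choose (6 * m) m * (6 * m + 1) =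
      (5 * m + 1) * (5 * m + 2).ascFactorial m := by
  have h1 := Nat.choose_mul_factorial_mul_factorial (n := 6 * m) (k := m) (by lia)
  rw [show 6 * m - m = 5 * m by lia] at h1
  have h2 := Nat.factorial_mul_ascFactorial (5 * m + 1) m
  rw [show 5 * m + 1 + m = 6 * m + 1 by ring, Nat.factorial_succ, Nat.factorial_succ, ← h1] at h2
  apply Nat.eq_of_mul_eq_mul_left (Nat.factorial_pos (5 * m))
  linarith

theorem Nat.choose_mul_mul_ascFactorial_two (m : ℕ) :
    Nat.factorial m * Nat.choose (10 * m) m * ((10 * m + 1) * (10 * m + 2)) =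
      (9 * m + 1) * (9 * m + 2) * (9 * m + 3).ascFactorial m := by
  have h1 := Nat.choose_mul_factorial_mul_factorial (n := 10 * m) (k := m) (by lia)
  rw [show 10 * m - m = 9 * m by lia] at h1
  have h2 := Nat.factorial_mul_ascFactorial (9 * m + 2) m
  rw [show 9 * m + 2 + m = 10 * m + 2 by ring, Nat.factorial_succ, Nat.factorial_succ,
    Nat.factorial_succ, Nat.factorial_succ, ← h1] at h2
  apply Nat.eq_of_mul_eq_mul_left (Nat.factorial_pos (9 * m))
  linarith

theorem Nat.choose_mul_mul_ascFactorial_sq (m : ℕ) :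
    Nat.choose (10 * m) (5 * m) * ((10 * m + 1) * (10 * m + 2)) *
        (4 * m + 2).ascFactorial m ^ 2 =
      Nat.choose (2 * (4 * m + 1)) (4 * m + 1) * ((8 * m + 3).ascFactorial m) *
        (9 * m + 3).ascFactorial m * (5 * m + 1) ^ 2 := by
  have h1 := Nat.choose_mul_factorial_mul_factorial (n := 10 * m) (k := 5 * m) (by lia)
  rw [show 10 * m - 5 * m = 5 * m by lia] at h1
  have h2 := Nat.factorial_mul_ascFactorial (9 * m + 2) m
  rw [show 9 * m + 2 + m = 10 * m + 1 + 1 by ring, Nat.factorial_succ (10 * m + 1),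
    Nat.factorial_succ (10 * m), ← h1] at h2
  have h3 := Nat.factorial_mul_ascFactorial (8 * m + 2) m
  rw [show 8 * m + 2 + m = 9 * m + 2 by ring] at h3
  have h4 := Nat.factorial_mul_ascFactorial (4 * m + 1) m
  rw [show 4 * m + 1 + m = 5 * m + 1 by ring, Nat.factorial_succ (5 * m)] at h4
  have h5 := Nat.choose_mul_factorial_mul_factorial (n := 2 * (4 * m + 1)) (k := 4 * m + 1) (by lia)
  rw [show 2 * (4 * m + 1) - (4 * m + 1) = 4 * m + 1 by lia,
    show 2 * (4 * m + 1) = 8 * m + 2 by ring] at h5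
  rw [← h3, ← h5] at h2
  apply Nat.eq_of_mul_eq_mul_left (pow_pos (Nat.factorial_pos (4 * m + 1)) 2)
  rw [show 2 * (4 * m + 1) = 8 * m + 2 by ring]
  calc _ = Nat.choose (10 * m) (5 * m) * ((10 * m + 1) * (10 * m + 2)) *
        ((4 * m + 1).factorial * (4 * m + 2).ascFactorial m) ^ 2 := by ring
    _ = ((10 * m + 1 + 1) * ((10 * m + 1) * ((10 * m).choose (5 * m) * (5 * m).factorial *
          (5 * m).factorial))) * (5 * m + 1) ^ 2 := by rw [h4]; ring
    _ = _ := by rw [← h2]; ring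

theorem Nat.ascFactorial_eq_two_pow_mul_prod_odd (m : ℕ) :
    (m + 1).ascFactorial m = 2 ^ m * ∏ j ∈ range m, (2 * j + 1) := by
  have h : ∀ m, Nat.factorial (2 * m) =
      Nat.factorial m * (2 ^ m * ∏ j ∈ range m, (2 * j + 1)) := by
    intro m
    induction m with
    | zero => simp
    | succ m ih =>
      rw [prod_range_succ, Nat.factorial_succ m, show 2 * (m + 1) = 2 * m + 1 + 1 by ring,
        Nat.factorial_succ, Nat.factorial_succ, ih]
      ring
  apply Nat.eq_of_mul_eq_mul_left (Nat.factorial_pos m)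
  rw [Nat.factorial_mul_ascFactorial, ← h, two_mul]

section TruncatedRing

variable {R : Type*} [CommRing R]

theorem two_mul_prod_add_of_pow_three_eq_zero {N : ℕ} (c r : ℕ → R)
    (hr : ∀ j < N, c j * r j = 1) {y : R} (hy : y ^ 3 = 0) :
    2 * ∏ j ∈ range N, (c j + y) = (∏ j ∈ range N, c j) *
      (2 + 2 * y * ∑ j ∈ range N, r j +
        y ^ 2 * ((∑ j ∈ range N, r j) ^ 2 - ∑ j ∈ range N, r j ^ 2)) := by
  obtain ⟨e, he⟩ := two_mul_prod_one_add_mul (range N) r y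
  have : ∏ j ∈ range N, (c j + y) = (∏ j ∈ range N, c j) * ∏ j ∈ range N, (1 + r j * y) := by
    rw [← prod_mul_distrib]
    refine prod_congr rfl fun j hj => ?_
    linear_combination -y * hr j (mem_range.mp hj)
  rw [this]
  linear_combination (∏ j ∈ range N, c j) * he + (∏ j ∈ range N, c j) * e * hy

theorem isUnit_prod_of_mul_eq_one {N : ℕ} (c r : ℕ → R) (hr : ∀ j < N, c j * r j = 1) :
    IsUnit (∏ j ∈ range N, c j) := by
  refine IsUnit.of_mul_eq_one (∏ j ∈ range N, r j) ?_
  rw [← prod_mul_distrib]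
  exact prod_eq_one fun j hj => hr j (mem_range.mp hj)

theorem cast_ascFactorial_add (a b m : ℕ) :
    (((a + b + 1).ascFactorial m : ℕ) : R) = ∏ j ∈ range m, ((b + j + 1 : R) + a) := by
  rw [Nat.ascFactorial_eq_prod_range]
  push_cast
  exact prod_congr rfl fun j _ => by ring

/-- Wolstenholme's congruence modulo `p ^ 3`. -/
theorem cast_choose_two_mul_self_eq_two {N : ℕ} (hN : Even N) (r : ℕ → R)
    (hr : ∀ j < N, ((j : R) + 1) * r j = 1) (hP : ((N + 1 : ℕ) : R) ^ 3 = 0)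
    (h2 : IsUnit (2 : R))
    (hd : ((N + 1 : ℕ) : R) ^ 2 * ∑ j ∈ range N, r j ^ 2 = 0)
    (hd1 : ((N + 1 : ℕ) : R) ^ 2 * ∑ j ∈ range N, r j = 0) :
    ((Nat.choose (2 * (N + 1)) (N + 1) : ℕ) : R) = 2 := by
  set P : R := ((N + 1 : ℕ) : R) with hPdef
  have hU := isUnit_prod_of_mul_eq_one (fun j => (j : R) + 1) r hr
  have hplus := two_mul_prod_add_of_pow_three_eq_zero (fun j => (j : R) + 1) r hr hP
  have hminus := two_mul_prod_add_of_pow_three_eq_zero (fun j => (j : R) + 1) r hr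
    (y := -P) (by linear_combination -hP)
  have hrefl : ∏ j ∈ range N, ((j : R) + 1 + -P) = ∏ j ∈ range N, ((j : R) + 1) := by
    rw [← prod_range_reflect]
    have : (-1 : R) ^ N = 1 := hN.neg_one_pow
    calc _ = ∏ j ∈ range N, (-1 * ((j : R) + 1)) := by
          refine prod_congr rfl fun j hj => ?_
          have hj := mem_range.mp hj
          have h3 : ((N - 1 - j + 1 + (j + 1) : ℕ) : R) = P := by
            rw [hPdef]; congr 1; lia
          push_cast at h3 ⊢
          linear_combination h3
      _ = _ := by rw [prod_mul_distrib, prod_const, card_range, this, one_mul]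
  rw [hrefl] at hminus
  have hF : (∏ j ∈ range N, ((j : R) + 1)) = ((Nat.factorial N : ℕ) : R) := by
    rw [← prod_range_add_one_eq_factorial]; push_cast; rfl
  have hnat : Nat.factorial N * Nat.choose (2 * (N + 1)) (N + 1) =
      2 * (N + 1 + 1).ascFactorial N := by
    have h1 := Nat.choose_mul_factorial_mul_factorial (n := 2 * (N + 1)) (k := N + 1) (by lia)
    rw [show 2 * (N + 1) - (N + 1) = N + 1 by lia] at h1
    have h3 := Nat.factorial_mul_ascFactorial (N + 1) N
    rw [show 2 * (N + 1) = N + 1 + N + 1 by ring, Nat.factorial_succ (N + 1 + N), ← h3,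
      Nat.factorial_succ N] at h1
    rw [show 2 * (N + 1) = N + 1 + N + 1 by ring]
    have h4 : 0 < (N + 1) ^ 2 * Nat.factorial N := by positivity
    apply Nat.eq_of_mul_eq_mul_left h4
    linarith
  have hcast := congrArg (Nat.cast : ℕ → R) hnat
  have hasc := cast_ascFactorial_add (R := R) (N + 1) 0 N
  rw [Nat.add_zero] at hasc
  push_cast at hcast hasc
  rw [hasc, ← hF] at hcast
  have hPc : (N : R) + 1 = P := by rw [hPdef]; push_cast; rfl
  simp only [hPc, zero_add] at hcast
  apply (hU.mul h2).mul_left_cancel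
  linear_combination 2 * hcast + 2 * hplus + 2 * hminus
    + (4 * ∑ j ∈ range N, r j) * (∏ j ∈ range N, ((j : R) + 1)) * hd1 -
    4 * (∏ j ∈ range N, ((j : R) + 1)) * hd

theorem four_pow_mul_eq_one_of_pow_three_eq_zero {m : ℕ} (r : ℕ → R) {P : R}
    (hPm : P = 4 * m + 1) (hP : P ^ 3 = 0) (h2 : IsUnit (2 : R))
    (hr : ∀ j < m, ((m : R) + j + 1) * r j = 1) :
    (-4) ^ m * (8 - 4 * P * ∑ j ∈ range m, r j +
      P ^ 2 * ((∑ j ∈ range m, r j) ^ 2 - ∑ j ∈ range m, r j ^ 2)) = 8 := by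
  obtain ⟨h, hh⟩ := h2.exists_right_inv
  have hU := isUnit_prod_of_mul_eq_one (fun j => (m : R) + j + 1) r hr
  have hprod := two_mul_prod_add_of_pow_three_eq_zero (fun j => (m : R) + j + 1) r hr
    (y := -(P * h)) (by linear_combination -h ^ 3 * hP)
  have hA := cast_ascFactorial_add (R := R) 0 m m
  rw [Nat.zero_add, Nat.ascFactorial_eq_two_pow_mul_prod_odd] at hA
  have hrefl : ∏ j ∈ range m, (2 * (j : R) + 1) =
      (-2) ^ m * ∏ j ∈ range m, ((m : R) + j + 1 + -(P * h)) := by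
    rw [← prod_range_reflect]
    calc _ = ∏ j ∈ range m, ((-2) * ((m : R) + j + 1 + -(P * h))) := by
          refine prod_congr rfl fun j hj => ?_
          have hj := mem_range.mp hj
          have h3 : ((m - 1 - j + (j + 1) : ℕ) : R) = m := by congr 1; lia
          push_cast at h3 ⊢
          linear_combination 2 * h3 - P * hh - hPm
      _ = _ := by rw [prod_mul_distrib, prod_const, card_range]
  have h4 : (2 : R) ^ m * (-2) ^ m = (-4) ^ m := by rw [← mul_pow]; norm_num
  push_cast at hA
  simp only [add_zero] at hA
  rw [hrefl, ← mul_assoc, h4] at hA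
  apply hU.mul_left_cancel
  linear_combination 8 * hA - 4 * (-4) ^ m * hprod
    + (-4) ^ m * (∏ j ∈ range m, ((m : R) + j + 1)) * (4 * P * ∑ j ∈ range m, r j
      - P ^ 2 * ((∑ j ∈ range m, r j) ^ 2 - ∑ j ∈ range m, r j ^ 2) * (2 * h + 1)) * hh

theorem choose_mul_eq_of_pow_three_eq_zero {m : ℕ} (r : ℕ → R) {P : R}
    (hPm : P = 4 * m + 1) (hP : P ^ 3 = 0) (h2 : IsUnit (2 : R))
    (hr : ∀ j < m + m, ((j : R) + 1) * r j = 1)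
    (hd : P ^ 2 * ∑ j ∈ range (m + m), r j ^ 2 = 0)
    (hW : ((Nat.choose (2 * (4 * m + 1)) (4 * m + 1) : ℕ) : R) = 2) :
    2 * (Nat.choose (6 * m) m : R) * (6 * m + 1) = (5 * m + 1) * Nat.centralBinom m *
      (2 + 2 * P * ∑ j ∈ range m, r (m + j) +
        P ^ 2 * ((∑ j ∈ range m, r (m + j)) ^ 2 - ∑ j ∈ range m, r (m + j) ^ 2)) ∧
    2 * (Nat.choose (10 * m) m : R) * ((10 * m + 1) * (10 * m + 2)) =
      (9 * m + 1) * (9 * m + 2) * Nat.centralBinom m *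
      (2 + 4 * P * ∑ j ∈ range m, r (m + j) +
        4 * P ^ 2 * ((∑ j ∈ range m, r (m + j)) ^ 2 - ∑ j ∈ range m, r (m + j) ^ 2)) ∧
    (Nat.choose (10 * m) (5 * m) : R) * ((10 * m + 1) * (10 * m + 2)) =
      (5 * m + 1) ^ 2 * Nat.centralBinom m *
      (2 + 4 * P * ∑ j ∈ range m, r (m + j) +
        4 * P ^ 2 * ((∑ j ∈ range m, r (m + j)) ^ 2 - ∑ j ∈ range m, r (m + j) ^ 2)) *
        (1 + P ^ 2 * ∑ j ∈ range m, r (m + j) ^ 2) := by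
  have hr1 : ∀ j < m, ((j : R) + 1) * r j = 1 := fun j hj => hr j (by lia)
  have hr2 : ∀ j < m, ((m : R) + j + 1) * r (m + j) = 1 := fun j hj => by
    have := hr (m + j) (by lia)
    push_cast at this
    exact this
  rw [sum_range_add] at hd
  have h2P : (2 * P) ^ 3 = 0 := by linear_combination 8 * hP
  have hU1 := isUnit_prod_of_mul_eq_one (fun j => (j : R) + 1) r hr1
  have hU2 := isUnit_prod_of_mul_eq_one (fun j => (m : R) + j + 1) _ hr2
  have a1 := two_mul_prod_add_of_pow_three_eq_zero (fun j => (j : R) + 1) r hr1 hP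
  have a2 := two_mul_prod_add_of_pow_three_eq_zero (fun j => (j : R) + 1) r hr1 h2P
  have b1 := two_mul_prod_add_of_pow_three_eq_zero (fun j => (m : R) + j + 1) _ hr2 hP
  have b2 := two_mul_prod_add_of_pow_three_eq_zero (fun j => (m : R) + j + 1) _ hr2 h2P
  have hF : (∏ j ∈ range m, ((j : R) + 1)) = ((Nat.factorial m : ℕ) : R) := by
    rw [← prod_range_add_one_eq_factorial]; push_cast; rfl
  have hC : ((Nat.factorial m : ℕ) : R) * Nat.centralBinom m =
      ∏ j ∈ range m, ((m : R) + j + 1) := by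
    have h1 := Nat.choose_mul_factorial_mul_factorial (n := 2 * m) (k := m) (by lia)
    have h3 := Nat.factorial_mul_ascFactorial m m
    rw [show 2 * m - m = m by lia, two_mul, ← h3, ← two_mul] at h1
    have h4 : Nat.factorial m * Nat.centralBinom m = (m + 1).ascFactorial m := by
      apply Nat.eq_of_mul_eq_mul_left (Nat.factorial_pos m)
      rw [Nat.centralBinom]
      linarith
    have hA := cast_ascFactorial_add (R := R) 0 m m
    rw [Nat.zero_add, ← h4] at hA
    push_cast at hA
    simpa using hA
  have c6 := congrArg (Nat.cast : ℕ → R) (Nat.choose_mul_mul_ascFactorial_one m)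
  have c10 := congrArg (Nat.cast : ℕ → R) (Nat.choose_mul_mul_ascFactorial_two m)
  have c105 := congrArg (Nat.cast : ℕ → R) (Nat.choose_mul_mul_ascFactorial_sq m)
  have e1 := cast_ascFactorial_add (R := R) (4 * m + 1) m m
  have e2 := cast_ascFactorial_add (R := R) (8 * m + 2) m m
  have e3 := cast_ascFactorial_add (R := R) (4 * m + 1) 0 m
  have e4 := cast_ascFactorial_add (R := R) (8 * m + 2) 0 m
  have hP1 : 4 * (m : R) + 1 = P := hPm.symm
  have hP2 : 8 * (m : R) + 2 = 2 * P := by rw [hPm]; ring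
  rw [show 4 * m + 1 + m + 1 = 5 * m + 2 by ring] at e1
  rw [show 8 * m + 2 + m + 1 = 9 * m + 3 by ring] at e2
  rw [show 4 * m + 1 + 0 + 1 = 4 * m + 2 by ring] at e3
  rw [show 8 * m + 2 + 0 + 1 = 8 * m + 3 by ring] at e4
  push_cast at c6 c10 c105 e1 e2 e3 e4
  simp only [hP1, hP2, zero_add] at e1 e2 e3 e4
  rw [e1, ← hF] at c6
  rw [e2, ← hF] at c10
  rw [e2, e3, e4, hW] at c105
  rw [← hF] at hC
  set F := ∏ j ∈ range m, ((j : R) + 1)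
  set A := ∏ j ∈ range m, ((m : R) + j + 1)
  set D1 := ∑ j ∈ range m, r (m + j)
  set d := ∑ j ∈ range m, r (m + j) ^ 2
  set H1 := ∑ j ∈ range m, r j
  set H2 := ∑ j ∈ range m, r j ^ 2
  refine ⟨?_, ?_, ?_⟩
  · apply hU1.mul_left_cancel
    linear_combination 2 * c6 + (5 * (m : R) + 1) * b1 - (5 * (m : R) + 1) *
      (2 + 2 * P * D1 + P ^ 2 * (D1 ^ 2 - d)) * hC
  · apply hU1.mul_left_cancel
    linear_combination 2 * c10 + (9 * (m : R) + 1) * (9 * m + 2) * b2 - (9 * (m : R) + 1) *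
      (9 * m + 2) * (2 + 4 * P * D1 + 4 * P ^ 2 * (D1 ^ 2 - d)) * hC
  · set u := 2 + 2 * P * H1 + P ^ 2 * (H1 ^ 2 - H2) with hu
    set v := 2 + 4 * P * D1 + 4 * P ^ 2 * (D1 ^ 2 - d) with hv
    set Q1 := ∏ j ∈ range m, ((j : R) + 1 + P)
    set Q2 := ∏ j ∈ range m, ((j : R) + 1 + 2 * P)
    set B := ∏ j ∈ range m, ((m : R) + j + 1 + 2 * P)
    set X := (Nat.choose (10 * m) (5 * m) : R)
    have hu_unit : IsUnit u := by
      refine isUnit_of_mul_isUnit_left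
        (y := 4 - 2 * P * (2 * H1 + P * (H1 ^ 2 - H2)) +
          P ^ 2 * (2 * H1 + P * (H1 ^ 2 - H2)) ^ 2) ?_
      have : u * (4 - 2 * P * (2 * H1 + P * (H1 ^ 2 - H2)) +
          P ^ 2 * (2 * H1 + P * (H1 ^ 2 - H2)) ^ 2) = 2 ^ 3 := by
        rw [hu]
        linear_combination (2 * H1 + P * (H1 ^ 2 - H2)) ^ 3 * hP
      rw [this]
      exact h2.pow 3
    have huw : 2 * (2 + 2 * (2 * P) * H1 + (2 * P) ^ 2 * (H1 ^ 2 - H2)) =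
        u ^ 2 * (1 + P ^ 2 * d) := by
      rw [hu]
      linear_combination -4 * hd - (4 * H1 * (H1 ^ 2 - H2) + P * (H1 ^ 2 - H2) ^ 2 +
        d * (8 * H1 + P * (2 * H1 + P * (H1 ^ 2 - H2)) ^ 2 + 4 * P * (H1 ^ 2 - H2))) * hP
    have hb : 2 * B = A * v := by rw [b2, hv]; ring
    apply ((hU1.pow 2).mul (hu_unit.pow 2)).mul_left_cancel
    calc F ^ 2 * u ^ 2 * (X * ((10 * m + 1) * (10 * m + 2)))
        = X * ((10 * m + 1) * (10 * m + 2)) * (2 * Q1) ^ 2 := by rw [a1]; ring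
      _ = 2 * (2 * Q2) * (2 * B) * (5 * m + 1) ^ 2 := by linear_combination 4 * c105
      _ = F * (2 * (2 + 2 * (2 * P) * H1 + (2 * P) ^ 2 * (H1 ^ 2 - H2))) *
          (F * Nat.centralBinom m * v) * (5 * m + 1) ^ 2 := by rw [a2, hb, hC]; ring
      _ = _ := by rw [huw]; ring

theorem jacobi_combination_of_pow_three_eq_zero {P C C6 C10 C105 D d : R} (hP : P ^ 3 = 0)
    (h2 : IsUnit (2 : R)) (h3 : IsUnit (3 : R))
    (h6 : 2 * C6 * (6 * P - 2) = (5 * P - 1) * C * (2 + 2 * P * D + P ^ 2 * (D ^ 2 - d)))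
    (h10 : 2 * C10 * ((10 * P - 6) * (10 * P - 2)) = (9 * P - 5) * (9 * P - 1) * C *
      (2 + 4 * P * D + 4 * P ^ 2 * (D ^ 2 - d)))
    (h105 : C105 * ((10 * P - 6) * (10 * P - 2)) = (5 * P - 1) ^ 2 * C *
      (2 + 4 * P * D + 4 * P ^ 2 * (D ^ 2 - d)) * (1 + P ^ 2 * d)) :
    2 * ((P - 1) * (15 * C - 20 * C6 + 6 * C10 + 3 * C105)) =
      -(C * (16 - 8 * P * D + P ^ 2 * (2 * D ^ 2 - d))) := by
  have e6 : -4 * C6 = (5 * P - 1) * (1 + 3 * P + 9 * P ^ 2) * C *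
      (2 + 2 * P * D + P ^ 2 * (D ^ 2 - d)) := by
    linear_combination (1 + 3 * P + 9 * P ^ 2) * h6 - 108 * C6 * hP
  have e10 : 216 * C10 = (9 * P - 5) * (9 * P - 1) * C * (9 + 60 * P + 325 * P ^ 2) *
      (2 + 4 * P * D + 4 * P ^ 2 * (D ^ 2 - d)) := by
    linear_combination (9 + 60 * P + 325 * P ^ 2) * h10 - 8 * C10 * (8125 * P - 5000) * hP
  have e105 : 108 * C105 = (5 * P - 1) ^ 2 * C * (9 + 60 * P + 325 * P ^ 2) *
      (2 + 4 * P * D + 4 * P ^ 2 * (D ^ 2 - d)) * (1 + P ^ 2 * d) := by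
    linear_combination (9 + 60 * P + 325 * P ^ 2) * h105 - 4 * C105 * (8125 * P - 5000) * hP
  have h54 : IsUnit (54 : R) := by
    have := h2.mul (h3.pow 3)
    norm_num at this
    exact this
  apply h54.mul_left_cancel
  linear_combination 540 * (P - 1) * e6 + 3 * (P - 1) * e10 + 3 * (P - 1) * e105 +
    C * ((38904 - 1386 * d + 4320 * D - 108 * D * d + 1620 * D ^ 2) +
      P * (-244740 - 6360 * d + 108 * d ^ 2 + 119928 * D + 468 * D * d +
        6480 * D ^ 2 - 108 * D ^ 2 * d) +
      P ^ 2 * (206700 - 130788 * d - 468 * d ^ 2 - 538080 * D + 240 * D * d +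
        140988 * D ^ 2 + 468 * D ^ 2 * d) +
      P ^ 3 * (503130 * d - 240 * d ^ 2 + 413400 * D + 20400 * D * d -
        562380 * D ^ 2 + 240 * D ^ 2 * d) +
      P ^ 4 * (-364650 * d - 20400 * d ^ 2 - 118500 * D * d + 413400 * D ^ 2 + 20400 * D ^ 2 * d) +
      P ^ 5 * (118500 * d ^ 2 + 97500 * D * d - 118500 * D ^ 2 * d) +
      P ^ 6 * (-97500 * d ^ 2 + 97500 * D ^ 2 * d)) * hP

end TruncatedRing

theorem eq_sq_of_pow_three_eq_zero {R : Type*} [CommRing R] {P C D d q ε s J S : R}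
    (hP : P ^ 3 = 0) (h2 : IsUnit (2 : R)) (hε : ε ^ 2 = 1)
    (hJ : 16 * J = -(ε * (C * (16 - 8 * P * D + P ^ 2 * (2 * D ^ 2 - d)))))
    (hq : q * (8 - 4 * P * D + P ^ 2 * (D ^ 2 - d)) = 8)
    (hS : q ^ 2 * S = C ^ 2 * (1 + P ^ 2 * s)) (hs : 8 * s = d) : S = J ^ 2 := by
  have h256 : IsUnit (256 : R) := by
    have := h2.pow 8
    norm_num at this
    exact this
  subst hs
  apply h256.mul_left_cancel
  set L := 8 - 4 * P * D + P ^ 2 * (D ^ 2 - 8 * s) with hL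
  have hK : (16 - 8 * P * D + P ^ 2 * (2 * D ^ 2 - 8 * s)) ^ 2 = 4 * L ^ 2 * (1 + P ^ 2 * s) := by
    rw [hL]
    linear_combination s * (128 * D - P * (96 * D ^ 2 - 320 * s) +
      P ^ 2 * (32 * D ^ 3 - 256 * D * s) -
      P ^ 3 * (4 * D ^ 4 - 64 * D ^ 2 * s + 256 * s ^ 2)) * hP
  calc 256 * S = 4 * (q * L) ^ 2 * S := by rw [hq]; ring
    _ = 4 * L ^ 2 * (q ^ 2 * S) := by ring
    _ = ε ^ 2 * C ^ 2 * (4 * L ^ 2 * (1 + P ^ 2 * s)) := by rw [hS, hε]; ring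
    _ = (16 * J) ^ 2 := by rw [← hK, hJ]; ring
    _ = 256 * J ^ 2 := by ring

theorem PadicInt.toZModPow_three_eq_zero_iff {p : ℕ} [Fact p.Prime] (x : ℤ_[p]) :
    PadicInt.toZModPow 3 x = 0 ↔ (p : ℤ_[p]) ^ 3 ∣ x := by
  rw [← RingHom.mem_ker, PadicInt.ker_toZModPow, Ideal.mem_span_singleton]

/-- The sum is congruent to the square of any `J` satisfying the stated congruence. -/
theorem pow_three_dvd_sum_sub_sq {p : ℕ} [Fact p.Prime] {m : ℕ} (hpm : p = 4 * m + 1)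
    {J : ℤ_[p]}
    (hJ : (p : ℤ_[p]) ^ 3 ∣ 8 * J - (p - 1) * (-1) ^ m * (15 * Nat.centralBinom m -
      20 * Nat.choose (6 * m) m + 6 * Nat.choose (10 * m) m + 3 * Nat.choose (10 * m) (5 * m))) :
    (p : ℤ_[p]) ^ 3 ∣ (∑ k ∈ range p,
      ((Nat.choose (2 * k) k : ℤ_[p]) ^ 3 * (Ring.inverse (64 : ℤ_[p])) ^ k)) - J ^ 2 := by
  have hp := Fact.out (p := p.Prime)
  have hm : 0 < m := by
    rcases Nat.eq_zero_or_pos m with rfl | h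
    · exact absurd hp (by rw [hpm]; decide)
    · exact h
  have hU : ∀ a : ℕ, 0 < a → a < p → IsUnit (a : ℤ_[p]) := fun a h0 h =>
    PadicInt.isUnit_natCast_of_lt h0 h
  set f := PadicInt.toZModPow (p := p) 3 with hf
  have hf0 : ∀ x, f x = 0 ↔ (p : ℤ_[p]) ^ 3 ∣ x := PadicInt.toZModPow_three_eq_zero_iff
  have hfu : ∀ a : ℕ, 0 < a → a < p → IsUnit (a : ZMod (p ^ 3)) := fun a h0 h => by
    simpa using (hU a h0 h).map f
  have h2 : IsUnit (2 : ZMod (p ^ 3)) := by exact_mod_cast hfu 2 (by norm_num) (by lia)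
  have h3 : IsUnit (3 : ZMod (p ^ 3)) := by exact_mod_cast hfu 3 (by norm_num) (by lia)
  have hP : (p : ZMod (p ^ 3)) ^ 3 = 0 := by
    have := (hf0 ((p : ℤ_[p]) ^ 3)).mpr dvd_rfl
    simpa using this
  have hPm : (p : ZMod (p ^ 3)) = 4 * m + 1 := by
    have : ((4 * m + 1 : ℕ) : ZMod (p ^ 3)) = p := by rw [← hpm]
    rw [← this]; push_cast; ring
  set ρ : ℕ → ℤ_[p] := fun j => Ring.inverse ((j : ℤ_[p]) + 1) with hρ
  have hρ1 : ∀ j < p - 1, ((j : ℤ_[p]) + 1) * ρ j = 1 := fun j hj =>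
    Ring.mul_inverse_cancel _ (by exact_mod_cast hU (j + 1) (by lia) (by lia))
  have hρZ : ∀ j < p - 1, PadicInt.toZMod (ρ j) = ((j : ZMod p) + 1)⁻¹ := fun j hj => by
    rw [hρ, PadicInt.toZMod_ringInverse (by exact_mod_cast hU (j + 1) (by lia) (by lia))]
    simp
  have hr : ∀ j < p - 1, ((j : ZMod (p ^ 3)) + 1) * f (ρ j) = 1 := fun j hj => by
    simpa using congrArg f (hρ1 j hj)
  have hvanish : ∀ (N i : ℕ), N ≤ p - 1 →
      ∑ j ∈ range N, ((j + 1 : ZMod p))⁻¹ ^ i = 0 →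
      (p : ZMod (p ^ 3)) ^ 2 * ∑ j ∈ range N, f (ρ j) ^ i = 0 := by
    intro N i hN h
    have h1 : PadicInt.toZMod (∑ j ∈ range N, ρ j ^ i) = 0 := by
      rw [map_sum, ← h]
      refine sum_congr rfl fun j hj => ?_
      rw [map_pow, hρZ j (by have := mem_range.mp hj; lia)]
    obtain ⟨e, he⟩ := (PadicInt.toZMod_eq_zero_iff _).mp h1
    have h4 : f ((p : ℤ_[p]) ^ 2 * ∑ j ∈ range N, ρ j ^ i) = 0 :=
      (hf0 _).mpr ⟨e, by rw [he]; ring⟩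
    simpa using h4
  have hN : ((p - 1 + 1 : ℕ) : ZMod (p ^ 3)) = p := by rw [Nat.sub_add_cancel hp.one_le]
  have hW : ((Nat.choose (2 * (4 * m + 1)) (4 * m + 1) : ℕ) : ZMod (p ^ 3)) = 2 := by
    have := cast_choose_two_mul_self_eq_two (R := ZMod (p ^ 3)) (N := p - 1) ⟨2 * m, by lia⟩
      (fun j => f (ρ j)) hr (by rw [hN, hP]) h2
      (by rw [hN]; exact hvanish _ 2 le_rfl (ZMod.sum_inv_pow_eq_zero (by norm_num) (by lia)))
      (by
        rw [hN]
        simpa using hvanish _ 1 le_rfl (ZMod.sum_inv_pow_eq_zero (by norm_num) (by lia)))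
    rwa [show p - 1 + 1 = 4 * m + 1 by lia] at this
  have hd := hvanish (m + m) 2 (by lia) (by rw [← two_mul]; exact ZMod.sum_inv_sq_half hpm)
  obtain ⟨c6, c10, c105⟩ := choose_mul_eq_of_pow_three_eq_zero (fun j => f (ρ j)) hPm hP h2
    (fun j hj => hr j (by lia)) hd hW
  have hq := four_pow_mul_eq_one_of_pow_three_eq_zero (fun j => f (ρ (m + j))) hPm hP h2
    (fun j hj => by simpa using hr (m + j) (by lia))
  have hcomb := jacobi_combination_of_pow_three_eq_zero (R := ZMod (p ^ 3)) hP h2 h3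
    (C6 := (Nat.choose (6 * m) m : ZMod (p ^ 3))) (C10 := (Nat.choose (10 * m) m : ZMod (p ^ 3)))
    (C105 := (Nat.choose (10 * m) (5 * m) : ZMod (p ^ 3)))
    (C := Nat.centralBinom m) (D := ∑ j ∈ range m, f (ρ (m + j)))
    (d := ∑ j ∈ range m, f (ρ (m + j)) ^ 2)
    (by rw [hPm] at c6 ⊢; linear_combination 4 * c6)
    (by rw [hPm] at c10 ⊢; linear_combination 16 * c10)
    (by rw [hPm] at c105 ⊢; linear_combination 16 * c105)
  have h8 : IsUnit (8 : ℤ_[p]) := by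
    have := (hU 2 (by norm_num) (by lia)).pow 3
    norm_num at this
    exact this
  set s : ℤ_[p] := Ring.inverse 8 * ∑ j ∈ range m, ρ (m + j) ^ 2 with hs
  have hs8 : 8 * s = ∑ j ∈ range m, ρ (m + j) ^ 2 := by
    rw [hs, ← mul_assoc, Ring.mul_inverse_cancel _ h8, one_mul]
  have hS := pow_three_dvd_sum_sub_centralBinom hpm s (by
    have := congrArg PadicInt.toZMod hs8
    rw [map_mul, map_ofNat, map_sum] at this
    rw [this]
    refine sum_congr rfl fun j hj => ?_
    rw [map_pow, hρZ _ (by have := mem_range.mp hj; lia)]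
    push_cast
    rfl)
  rw [← hf0, map_sub, sub_eq_zero] at hS hJ ⊢
  rw [map_pow]
  have hq2 : ((-4 : ZMod (p ^ 3)) ^ m) ^ 2 = 16 ^ m := by
    rw [← pow_mul, mul_comm, pow_mul]; norm_num
  refine eq_sq_of_pow_three_eq_zero (C := (Nat.centralBinom m : ZMod (p ^ 3))) (q := (-4) ^ m)
    (ε := (-1) ^ m) (s := f s) hP h2 ?_ ?_ hq ?_ ?_
  · rw [← pow_mul, mul_comm, pow_mul]; norm_num
  · simp only [map_mul, map_sub, map_add, map_pow, map_neg, map_one, map_natCast, map_ofNat] at hJ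
    linear_combination 2 * hJ + (-1) ^ m * hcomb
  · rw [hq2]
    simp only [map_mul, map_add, map_pow, map_one, map_natCast, map_ofNat] at hS
    exact hS
  · have := congrArg f hs8
    simpa only [map_mul, map_sum, map_pow, map_ofNat] using this

theorem PadicInt.ringHom_eq_toZMod {p : ℕ} [Fact p.Prime] (g : ℤ_[p] →+* ZMod p) :
    g = PadicInt.toZMod := by
  apply ZMod.ringHom_eq_of_ker_eq
  rw [PadicInt.ker_toZMod]
  exact IsLocalRing.eq_maximalIdeal
    (RingHom.ker_isMaximal_of_surjective g (ZMod.ringHom_surjective g))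

/-- The Teichmüller character with values in `ℤ_[p]`. -/
noncomputable def teichmullerChar (p : ℕ) [Fact p.Prime] : MulChar (ZMod p) ℤ_[p] where
  toFun x := WittVector.equiv p (WittVector.teichmuller p x)
  map_one' := by simp
  map_mul' x y := by simp
  map_nonunit' x hx := by
    have : x = 0 := by simpa using hx
    rw [this, WittVector.teichmuller_zero, map_zero]

theorem toZMod_teichmullerChar {p : ℕ} [Fact p.Prime] (x : ZMod p) :
    PadicInt.toZMod (teichmullerChar p x) = x := by
  have h := PadicInt.ringHom_eq_toZMod (p := p)
    ((WittVector.constantCoeff (p := p)).comp (WittVector.equiv p).symm.toRingHom)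
  rw [← h]
  change WittVector.constantCoeff ((WittVector.equiv p).symm
    (WittVector.equiv p (WittVector.teichmuller p x))) = x
  rw [RingEquiv.symm_apply_apply]
  exact WittVector.teichmuller_coeff_zero p x

theorem teichmullerChar_pow_card_sub_one {p : ℕ} [Fact p.Prime] :
    teichmullerChar p ^ (p - 1) = 1 := by
  have hp := (Fact.out : p.Prime).two_le
  ext x
  rw [MulChar.pow_apply' _ (by lia), ← map_pow]
  have hx : (x : ZMod p) ^ (p - 1) = 1 := ZMod.pow_card_sub_one_eq_one x.ne_zero
  rw [hx, map_one, MulChar.one_apply_coe]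

theorem teichmullerChar_pow_eq_one_iff {p : ℕ} [Fact p.Prime] {k : ℕ} (hk : k ≠ 0) :
    teichmullerChar p ^ k = 1 ↔ p - 1 ∣ k := by
  constructor
  · intro h
    have := FiniteField.forall_pow_eq_one_iff (ZMod p) k
    rw [ZMod.card] at this
    rw [← this]
    intro x
    ext
    have h1 := congrArg (fun χ : MulChar (ZMod p) ℤ_[p] => PadicInt.toZMod (χ x)) h
    simp only [MulChar.pow_apply' _ hk, MulChar.one_apply_coe, map_pow, map_one,
      toZMod_teichmullerChar] at h1
    simpa using h1
  · rintro ⟨c, rfl⟩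
    rw [pow_mul, teichmullerChar_pow_card_sub_one, one_pow]

theorem sum_teichmullerChar_pow {p : ℕ} [Fact p.Prime] {k : ℕ} (hk : k ≠ 0) :
    ∑ x, teichmullerChar p x ^ k = if p - 1 ∣ k then (p : ℤ_[p]) - 1 else 0 := by
  have h : ∀ x, teichmullerChar p x ^ k = (teichmullerChar p ^ k) x := fun x =>
    (MulChar.pow_apply' _ hk x).symm
  simp only [h]
  split_ifs with hd
  · rw [(teichmullerChar_pow_eq_one_iff hk).mpr hd, MulChar.sum_one_eq_card_units,
      ZMod.card_units_eq_totient, Nat.totient_prime Fact.out,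
      Nat.cast_sub (Fact.out : p.Prime).one_le, Nat.cast_one]
  · exact MulChar.sum_eq_zero_of_ne_one fun h => hd ((teichmullerChar_pow_eq_one_iff hk).mp h)

theorem sum_teichmullerChar_mul_one_sub_pow {p : ℕ} [Fact p.Prime] {m : ℕ}
    (hpm : p = 4 * m + 1) (t : ℕ) :
    ∑ x, teichmullerChar p x ^ (3 * m) * (1 - teichmullerChar p x) ^ ((4 * t + 2) * m) =
      (p - 1) * (-1) ^ m * ∑ l ∈ range (t + 1),
        (Nat.choose ((4 * t + 2) * m) ((4 * l + 1) * m) : ℤ_[p]) := by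
  have hp := Fact.out (p := p.Prime)
  have hm : 0 < m := by
    rcases Nat.eq_zero_or_pos m with rfl | h
    · exact absurd hp (by rw [hpm]; decide)
    · exact h
  set N := (4 * t + 2) * m with hN
  have h1 : ∀ x, teichmullerChar p x ^ (3 * m) * (1 - teichmullerChar p x) ^ N =
      ∑ j ∈ range (N + 1), (-1) ^ j * (Nat.choose N j : ℤ_[p]) *
        teichmullerChar p x ^ (3 * m + j) := by
    intro x
    rw [sub_eq_neg_add, add_pow, mul_sum]
    refine sum_congr rfl fun j _ => ?_
    rw [neg_pow]; ring
  simp only [h1]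
  rw [sum_comm]
  simp only [← mul_sum]
  have h2 : ∀ j, ∑ x, teichmullerChar p x ^ (3 * m + j) =
      if 4 * m ∣ 3 * m + j then (p : ℤ_[p]) - 1 else 0 := fun j => by
    rw [sum_teichmullerChar_pow (by lia), show p - 1 = 4 * m by lia]
  simp only [h2, mul_ite, mul_zero]
  rw [← sum_filter]
  have h3 : {j ∈ range (N + 1) | 4 * m ∣ 3 * m + j} =
      (range (t + 1)).image fun l => (4 * l + 1) * m := by
    ext j
    simp only [mem_filter, mem_range, mem_image]
    constructor
    · rintro ⟨hj, c, hc⟩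
      have hc0 : c ≠ 0 := by rintro rfl; lia
      refine ⟨c - 1, ?_, ?_⟩
      · by_contra hcon
        have : 4 * m * (t + 2) ≤ 4 * m * c := Nat.mul_le_mul_left _ (by lia)
        nlinarith
      · obtain ⟨c, rfl⟩ := Nat.exists_eq_succ_of_ne_zero hc0
        simp only [Nat.succ_eq_add_one, Nat.add_sub_cancel] at hc ⊢
        nlinarith
    · rintro ⟨l, hl, rfl⟩
      refine ⟨?_, l + 1, by ring⟩
      have : (4 * l + 1) * m ≤ (4 * t + 2) * m := Nat.mul_le_mul_right _ (by lia)
      lia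
  rw [h3, sum_image, mul_sum]
  · refine sum_congr rfl fun l _ => ?_
    have : (-1 : ℤ_[p]) ^ ((4 * l + 1) * m) = (-1) ^ m := by
      rw [pow_mul, pow_add, pow_mul]; norm_num
    rw [this]; ring
  · intro a _ b _ h
    have := Nat.eq_of_mul_eq_mul_right hm h
    lia

theorem pow_three_dvd_of_sq_eq_one {R : Type*} [CommRing R] {P e w : R} (he : e ^ 2 = 1)
    (h : P ∣ w - e) : P ^ 3 ∣ 8 * e - (15 * w - 10 * w ^ 3 + 3 * w ^ 5) := by
  have : 8 * e - (15 * w - 10 * w ^ 3 + 3 * w ^ 5) =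
      (w - e) ^ 3 * (-(3 * w ^ 2 + 9 * e * w + 8)) := by
    linear_combination (15 * w - 8 * e - 9 * w * e ^ 2 - 18 * w ^ 3 + 24 * w ^ 2 * e) * he
  rw [this]
  exact (pow_dvd_pow_of_dvd h 3).mul_right _

theorem pow_three_dvd_jacobiSum {p : ℕ} [Fact p.Prime] {m : ℕ} (hpm : p = 4 * m + 1) :
    (p : ℤ_[p]) ^ 3 ∣ 8 * jacobiSum (teichmullerChar p ^ (3 * m)) (teichmullerChar p ^ (2 * m)) -
      (p - 1) * (-1) ^ m * (15 * Nat.centralBinom m -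
      20 * Nat.choose (6 * m) m + 6 * Nat.choose (10 * m) m + 3 * Nat.choose (10 * m) (5 * m)) := by
  have hp := Fact.out (p := p.Prime)
  have hm : 0 < m := by
    rcases Nat.eq_zero_or_pos m with rfl | h
    · exact absurd hp (by rw [hpm]; decide)
    · exact h
  have key : ∀ x : ZMod p, (p : ℤ_[p]) ^ 3 ∣
      8 * (teichmullerChar p x ^ (3 * m) * teichmullerChar p (1 - x) ^ (2 * m)) -
      (15 * (teichmullerChar p x ^ (3 * m) * (1 - teichmullerChar p x) ^ ((4 * 0 + 2) * m)) -
      10 * (teichmullerChar p x ^ (3 * m) * (1 - teichmullerChar p x) ^ ((4 * 1 + 2) * m)) +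
      3 * (teichmullerChar p x ^ (3 * m) * (1 - teichmullerChar p x) ^ ((4 * 2 + 2) * m))) := by
    intro x
    by_cases hx : x = 1
    · subst hx
      simp [hm.ne', MulChar.map_zero]
    have hx' : 1 - x ≠ 0 := sub_ne_zero.mpr (Ne.symm hx)
    have h1 := pow_three_dvd_of_sq_eq_one (P := (p : ℤ_[p]))
      (e := teichmullerChar p (1 - x) ^ (2 * m)) (w := (1 - teichmullerChar p x) ^ (2 * m))
      (by
        rw [← pow_mul, ← map_pow, show 2 * m * 2 = p - 1 by lia,
          ZMod.pow_card_sub_one_eq_one hx', map_one])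
      (by
        rw [← PadicInt.toZMod_eq_zero_iff]
        simp [toZMod_teichmullerChar])
    have h2 := h1.mul_left (teichmullerChar p x ^ (3 * m))
    convert h2 using 1
    ring
  have h := dvd_sum fun x (_ : x ∈ (univ : Finset (ZMod p))) => key x
  simp only [sum_sub_distrib, sum_add_distrib, ← mul_sum, sum_teichmullerChar_mul_one_sub_pow hpm]
    at h
  have hJ : jacobiSum (teichmullerChar p ^ (3 * m)) (teichmullerChar p ^ (2 * m)) =
      ∑ x, teichmullerChar p x ^ (3 * m) * teichmullerChar p (1 - x) ^ (2 * m) := by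
    rw [jacobiSum]
    refine sum_congr rfl fun x _ => ?_
    rw [MulChar.pow_apply' _ (by lia), MulChar.pow_apply' _ (by lia)]
  rw [hJ]
  convert h using 2
  have e1 : Nat.choose (6 * m) (5 * m) = Nat.choose (6 * m) m :=
    Nat.choose_symm_of_eq_add (by ring)
  have e2 : Nat.choose (10 * m) (9 * m) = Nat.choose (10 * m) m :=
    Nat.choose_symm_of_eq_add (by ring)
  simp only [sum_range_succ, range_zero, sum_empty, zero_add, mul_zero, mul_one, one_mul,
    Nat.reduceMul, Nat.reduceAdd, e1, e2, Nat.centralBinom]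
  ring

theorem PadicInt.natCast_dvd_intCast_iff {p : ℕ} [Fact p.Prime] (a : ℤ) :
    (p : ℤ_[p]) ∣ (a : ℤ_[p]) ↔ (p : ℤ) ∣ a := by
  rw [← PadicInt.toZMod_eq_zero_iff, map_intCast, ZMod.intCast_zmod_eq_zero_iff_dvd]

/-- If `y` is a fourth root of unity in a domain with a square root `i` of `-1`, then `y` and its
inverse are the images of conjugate Gaussian integers. -/
theorem exists_gaussianInt_of_pow_four_eq_one {R : Type*} [CommRing R] [IsDomain R]
    (g : GaussianInt →+* R) {y y' : R} (hy : y ^ 4 = 1) (h : y * y' = 1) :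
    ∃ z, g z = y ∧ g (star z) = y' := by
  set i := g ⟨0, 1⟩ with hi
  have hi2 : i * i = -1 := by
    rw [hi, ← map_mul, ← map_one g, ← map_neg]; rfl
  have hs : g (star ⟨0, 1⟩) = -i := by
    rw [hi, ← map_neg]; rfl
  have hy0 : y ≠ 0 := left_ne_zero_of_mul_eq_one h
  have key : ∀ z, g z = y → g z * g (star z) = 1 → ∃ z, g z = y ∧ g (star z) = y' := by
    intro z hz h1
    refine ⟨z, hz, mul_left_cancel₀ hy0 ?_⟩
    rw [h, ← h1, hz]
  have hf : (y - 1) * ((y + 1) * ((y - i) * (y + i))) = 0 := by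
    linear_combination hy + (1 - y ^ 2) * hi2
  rcases mul_eq_zero.mp hf with h1 | h1
  · exact key 1 (by rw [map_one]; linear_combination -h1) (by simp)
  rcases mul_eq_zero.mp h1 with h1 | h1
  · exact key (-1) (by rw [map_neg, map_one]; linear_combination -h1) (by simp)
  rcases mul_eq_zero.mp h1 with h1 | h1
  · exact key ⟨0, 1⟩ (by rw [← hi]; linear_combination -h1)
      (by rw [hs, ← hi]; linear_combination -hi2)
  · exact key (-⟨0, 1⟩) (by rw [map_neg, ← hi]; linear_combination -h1)
      (by rw [star_neg, map_neg, map_neg, hs, ← hi]; linear_combination -hi2)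

theorem MulChar.exists_gaussianInt_apply {F R : Type*} [Field F] [CommRing R] [IsDomain R]
    (g : GaussianInt →+* R) {χ : MulChar F R} (hχ : χ ^ 4 = 1) (x : F) :
    ∃ z, g z = χ x ∧ g (star z) = χ⁻¹ x := by
  rcases eq_or_ne x 0 with rfl | hx
  · exact ⟨0, by simp⟩
  apply exists_gaussianInt_of_pow_four_eq_one
  · rw [← MulChar.pow_apply' _ (by norm_num), hχ, MulChar.one_apply hx.isUnit]
  · rw [MulChar.inv_apply', ← map_mul, mul_inv_cancel₀ hx, map_one]

theorem exists_gaussianInt_jacobiSum {F R : Type*} [Field F] [Fintype F] [CommRing R] [IsDomain R]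
    (g : GaussianInt →+* R) {χ ψ : MulChar F R} (hχ : χ ^ 4 = 1) (hψ : ψ ^ 4 = 1) :
    ∃ z, g z = jacobiSum χ ψ ∧ g (star z) = jacobiSum χ⁻¹ ψ⁻¹ := by
  choose s hs hs' using MulChar.exists_gaussianInt_apply g hχ
  choose t ht ht' using MulChar.exists_gaussianInt_apply g hψ
  refine ⟨∑ x, s x * t (1 - x), ?_, ?_⟩
  · simp [jacobiSum, hs, ht]
  · simp [jacobiSum, hs', ht', star_sum]

theorem exists_gaussianInt_of_mem_adjoin {R : Type*} [CommRing R] (g : GaussianInt →+* R) {w : R}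
    (hw : w ∈ Algebra.adjoin ℤ {g ⟨0, 1⟩}) : ∃ z, g z = w := by
  have : Algebra.adjoin ℤ {g ⟨0, 1⟩} ≤ g.toIntAlgHom.range := by
    rw [Algebra.adjoin_le_iff, Set.singleton_subset_iff]
    exact ⟨⟨0, 1⟩, rfl⟩
  exact this hw

/-- The Jacobi sum of two characters of order dividing four is `g z` for a Gaussian integer `z`
of norm `#F` with odd real part. -/
theorem exists_gaussianInt_norm_eq_card {F R : Type*} [Field F] [Fintype F] [CommRing R]
    [IsDomain R] [CharZero R] (g : GaussianInt →+* R) (hg : Function.Injective g)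
    {χ ψ : MulChar F R} (hχ : χ ^ 4 = 1) (hψ : ψ ^ 4 = 1) (hχ1 : χ ≠ 1) (hψ1 : ψ ≠ 1)
    (hχψ : χ * ψ ≠ 1) (hF : 4 ∣ Fintype.card F - 1) :
    ∃ z, g z = jacobiSum χ ψ ∧ z.norm = Fintype.card F ∧ Odd z.re := by
  obtain ⟨z, hz, hz'⟩ := exists_gaussianInt_jacobiSum g hχ hψ
  refine ⟨z, hz, ?_, ?_⟩
  · have hinj := IsFractionRing.injective R (FractionRing R)
    have hchar : CharZero (FractionRing R) := charZero_of_injective_algebraMap hinj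
    have h := jacobiSum_mul_jacobiSum_inv (F' := FractionRing R)
      (χ := χ.ringHomComp (algebraMap R (FractionRing R)))
      (φ := ψ.ringHomComp (algebraMap R (FractionRing R)))
      (by
        rw [ringChar.eq_zero]
        exact (CharP.ringChar_ne_zero_of_finite F).symm)
      ((MulChar.ringHomComp_ne_one_iff hinj).mpr hχ1)
      ((MulChar.ringHomComp_ne_one_iff hinj).mpr hψ1)
      (by rwa [← MulChar.ringHomComp_mul, MulChar.ringHomComp_ne_one_iff hinj])
    rw [MulChar.ringHomComp_inv, MulChar.ringHomComp_inv, jacobiSum_ringHomComp,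
      jacobiSum_ringHomComp, ← map_mul, ← map_natCast (algebraMap R (FractionRing R)),
      hinj.eq_iff, ← hz, ← hz', ← map_mul, ← Zsqrtd.norm_eq_mul_conj, map_intCast] at h
    exact_mod_cast h
  · have hμ : IsPrimitiveRoot (g ⟨0, 1⟩) 4 := by
      refine IsPrimitiveRoot.map_of_injective ?_ hg
      refine (IsPrimitiveRoot.iff (by norm_num)).mpr ⟨rfl, fun l h0 hl => ?_⟩
      interval_cases l <;> decide
    obtain ⟨w, hw, h⟩ := exists_jacobiSum_eq_neg_one_add (by norm_num) hχ hψ hF hμ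
    obtain ⟨w, rfl⟩ := exists_gaussianInt_of_mem_adjoin g hw
    rw [← hz, ← map_one g, ← map_sub, ← map_pow, ← map_mul, ← map_neg, ← map_add,
      hg.eq_iff] at h
    refine ⟨w.im - 1, ?_⟩
    rw [h]
    simp [sq, Zsqrtd.re_mul, Zsqrtd.im_mul]
    ring

/-- Two Gaussian integers of norm `p`, both with odd real part and not divisible by the same prime
above `p`, have the same square. -/
theorem GaussianInt.sq_eq_sq_of_norm_eq {p : ℕ} [Fact p.Prime] (hp : 2 < p)
    (g : GaussianInt →+* ℤ_[p]) {z t : GaussianInt} (hz : z.norm = p) (ht : t.norm = p)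
    (hzr : Odd z.re) (htr : Odd t.re) (hgz : ¬ (p : ℤ_[p]) ∣ g z) (hgt : ¬ (p : ℤ_[p]) ∣ g t) :
    g z ^ 2 = g t ^ 2 := by
  have hprime : Prime (p : ℤ_[p]) := PadicInt.prime_p
  have hodd : Odd (p : ℤ) := by
    exact_mod_cast (Fact.out : p.Prime).odd_of_ne_two hp.ne'
  have hmul : ∀ w : GaussianInt, w.norm = p → g w * g (star w) = p := fun w hw => by
    rw [← map_mul, ← Zsqrtd.norm_eq_mul_conj, hw]; simp
  have hz' : (p : ℤ_[p]) ∣ g (star z) :=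
    (hprime.dvd_or_dvd (hmul z hz).symm.dvd).resolve_left hgz
  have ht' : (p : ℤ_[p]) ∣ g (star t) :=
    (hprime.dvd_or_dvd (hmul t ht).symm.dvd).resolve_left hgt
  have hzn := hz
  have htn := ht
  rw [Zsqrtd.norm_def] at hzn htn
  have hsum : t * star z + star t * z = ((2 * (t.re * z.re + t.im * z.im) : ℤ) : GaussianInt) := by
    ext <;> simp <;> ring
  have hd : (p : ℤ) ∣ 2 * (t.re * z.re + t.im * z.im) := by
    rw [← PadicInt.natCast_dvd_intCast_iff, ← map_intCast g, ← hsum, map_add, map_mul, map_mul]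
    exact dvd_add (hz'.mul_left _) (ht'.mul_right _)
  have hpZ : Prime (p : ℤ) := Nat.prime_iff_prime_int.mp Fact.out
  obtain ⟨k, hk⟩ : (p : ℤ) ∣ t.re * z.re + t.im * z.im := by
    refine (hpZ.dvd_or_dvd hd).resolve_left fun h => ?_
    have := Int.le_of_dvd (by norm_num) h
    lia
  have hpos : (0 : ℤ) < p := by lia
  have hzi : Even z.im := by
    by_contra h
    rw [Int.not_even_iff_odd] at h
    have : Even (p : ℤ) := by
      rw [← hzn]; simpa using (hzr.mul hzr).add_odd (h.mul h)
    exact (Int.not_even_iff_odd.mpr hodd) this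
  have hid : (t.re * z.re + t.im * z.im) ^ 2 + (t.im * z.re - t.re * z.im) ^ 2 = (p : ℤ) ^ 2 := by
    linear_combination (t.re ^ 2 + t.im ^ 2) * hzn + p * htn
  have hk0 : k ≠ 0 := by
    rintro rfl
    rw [mul_zero] at hk
    have : Odd (t.re * z.re + t.im * z.im) := (htr.mul hzr).add_even (hzi.mul_left _)
    rw [hk] at this
    exact absurd this (by decide)
  have hk1 : 1 ≤ k ^ 2 := by
    have : 0 < k ^ 2 := by positivity
    lia
  rw [hk] at hid
  have him : t.im * z.re - t.re * z.im = 0 := by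
    have : (t.im * z.re - t.re * z.im) ^ 2 ≤ 0 := by nlinarith [sq_nonneg (p : ℤ)]
    exact pow_eq_zero_iff (by norm_num) |>.mp (le_antisymm this (sq_nonneg _))
  have hk2 : k ^ 2 = 1 := by
    rw [him] at hid
    have : (p : ℤ) ^ 2 * k ^ 2 = p ^ 2 * 1 := by linear_combination hid
    exact mul_left_cancel₀ (pow_ne_zero 2 hpos.ne') this
  have hts : t * star z = ((p * k : ℤ) : GaussianInt) := by
    rw [← hk]
    ext
    · simp
    · simp; linear_combination him
  have h : (z.norm : GaussianInt) * t = ((p * k : ℤ) : GaussianInt) * z := by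
    rw [Zsqrtd.norm_eq_mul_conj, ← hts]; ring
  rw [hz] at h
  have hp0 : ((p : ℤ) : GaussianInt) ≠ 0 := by
    exact_mod_cast hpos.ne'
  have htk : t = k * z := mul_left_cancel₀ hp0 (by rw [h]; push_cast; ring)
  rw [htk, map_mul, mul_pow, map_intCast, ← Int.cast_pow, hk2, Int.cast_one, one_mul]

theorem not_dvd_sum_centralBinom_pow_three {p : ℕ} [Fact p.Prime] {m : ℕ} (hpm : p = 4 * m + 1) :
    ¬ (p : ℤ_[p]) ∣ ∑ k ∈ range p,
      ((Nat.choose (2 * k) k : ℤ_[p]) ^ 3 * (Ring.inverse (64 : ℤ_[p])) ^ k) := by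
  intro h
  have hp := Fact.out (p := p.Prime)
  have hm : 0 < m := by
    rcases Nat.eq_zero_or_pos m with rfl | h
    · exact absurd hp (by rw [hpm]; decide)
    · exact h
  have h8 : (8 : ZMod p) ≠ 0 := by
    have := (PadicInt.isUnit_ofNat_two (p := p) (by lia)).map (PadicInt.toZMod (p := p))
    rw [map_ofNat] at this
    rw [show (8 : ZMod p) = 2 ^ 3 by norm_num]
    exact (this.pow 3).ne_zero
  obtain ⟨s, hs⟩ := ZMod.ringHom_surjective (PadicInt.toZMod (p := p))
    (8⁻¹ * ∑ j ∈ range m, ((m + j + 1 : ZMod p))⁻¹ ^ 2)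
  have h1 := pow_three_dvd_sum_sub_centralBinom hpm s (by rw [hs, mul_inv_cancel_left₀ h8])
  have h2 := (dvd_sub_right (h.mul_left (16 ^ m))).mp ((dvd_pow_self _ (by norm_num)).trans h1)
  rw [mul_add, mul_one] at h2
  have h3 := (dvd_add_left (((dvd_pow_self (p : ℤ_[p]) two_ne_zero).mul_right s).mul_left _)).mp h2
  have h4 : p ∣ Nat.centralBinom m := by
    have := PadicInt.prime_p.dvd_of_dvd_pow h3
    rwa [← PadicInt.toZMod_eq_zero_iff, map_natCast, ZMod.natCast_eq_zero_iff] at this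
  have h5 : p ∣ (2 * m).factorial := h4.trans (by
    rw [← Nat.choose_mul_factorial_mul_factorial (show m ≤ 2 * m by lia), mul_assoc]
    exact Dvd.intro _ rfl)
  rw [hp.dvd_factorial] at h5
  lia

end

/-- Long–Ramakrishna: for a prime `p = u² + v²` with `v` even and `u + v i` a `p`-adic unit,
`∑_{k<p} binom(2k,k)³ 64^{-k} ≡ (u + v i)² mod p³`. -/
theorem stmt_5 (p : ℕ) [Fact p.Prime] (u v : ℤ) (i : ℤ_[p]) (hi : i ^ 2 = -1)
    (huv : (p : ℤ) = u ^ 2 + v ^ 2) (hv : Even v)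
    (hunit : IsUnit ((u : ℤ_[p]) + v * i)) :
    (p : ℤ_[p]) ^ 3 ∣
      (∑ k ∈ Finset.range p,
          ((Nat.choose (2 * k) k : ℤ_[p]) ^ 3 * (Ring.inverse (64 : ℤ_[p])) ^ k))
        - ((u : ℤ_[p]) + v * i) ^ 2 := by
  have hp := Fact.out (p := p.Prime)
  have hu : Odd u := by
    rw [← Int.not_even_iff_odd]
    rintro hu
    obtain ⟨a, rfl⟩ := hu
    obtain ⟨b, rfl⟩ := hv
    have h4 : 2 * 2 ∣ p := by
      have : (4 : ℤ) ∣ p := ⟨a ^ 2 + b ^ 2, by rw [huv]; ring⟩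
      exact_mod_cast this
    exact (Nat.squarefree_iff_prime_squarefree.mp hp.prime.squarefree 2 Nat.prime_two) h4
  obtain ⟨m, hpm⟩ : ∃ m, p = 4 * m + 1 := by
    obtain ⟨a, rfl⟩ := hu
    obtain ⟨b, rfl⟩ := hv
    refine ⟨(a ^ 2 + a + b ^ 2).toNat, ?_⟩
    zify
    rw [Int.toNat_of_nonneg (by nlinarith), huv]
    ring
  have hm : 0 < m := by
    rcases Nat.eq_zero_or_pos m with rfl | h
    · exact absurd hp (by rw [hpm]; decide)
    · exact h
  set g : GaussianInt →+* ℤ_[p] := Zsqrtd.lift ⟨i, by rw [← sq, hi]; simp⟩ with hg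
  have hginj : Function.Injective g := Zsqrtd.lift_injective _ fun n h => by nlinarith
  have hgt : g ⟨u, v⟩ = u + v * i := by simp [hg]
  have hcard : Fintype.card (ZMod p) = p := ZMod.card p
  have hchar : ∀ k ≠ 0, ¬ 4 ∣ k → teichmullerChar p ^ (k * m) ≠ 1 := fun k hk h4 h => by
    rw [teichmullerChar_pow_eq_one_iff (by positivity), show p - 1 = 4 * m by lia] at h
    exact h4 (Nat.dvd_of_mul_dvd_mul_right hm h)
  have hchar4 : ∀ k, (teichmullerChar p ^ (k * m)) ^ 4 = 1 := fun k => by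
    rw [← pow_mul, show k * m * 4 = (p - 1) * k by rw [hpm]; simp; ring, pow_mul,
      teichmullerChar_pow_card_sub_one, one_pow]
  obtain ⟨z, hz, hzn, hzr⟩ := exists_gaussianInt_norm_eq_card g hginj (hchar4 3) (hchar4 2)
    (hchar 3 (by norm_num) (by norm_num)) (hchar 2 (by norm_num) (by norm_num))
    (by rw [← pow_add, ← add_mul]; exact hchar 5 (by norm_num) (by norm_num))
    (by rw [hcard]; lia)
  have hsum := pow_three_dvd_sum_sub_sq hpm (pow_three_dvd_jacobiSum hpm)
  rw [← hz] at hsum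
  rwa [← hgt, ← GaussianInt.sq_eq_sq_of_norm_eq (by lia) g (by rw [hzn, hcard]) ?_ hzr hu ?_ ?_]
  · rw [Zsqrtd.norm_def, huv]; ring
  · intro h
    exact not_dvd_sum_centralBinom_pow_three hpm
      ((dvd_sub_left (h.pow two_ne_zero)).mp ((dvd_pow_self _ three_ne_zero).trans hsum))
  · rw [hgt]
    exact fun h => PadicInt.prime_p.not_isUnit (isUnit_of_dvd_unit h hunit)
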